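/- arXiv:1606.08036 — 5 statements merged into one kernel-verified Lean document; each statement's English description precedes it below -/
import Mathlib

section
/- Let G_3 be given by presentation (1.4) and let W be a word over A^{±1} such that W = 1 in G_3 and |W|_{\bar a_1} > 2, and let N be the minimal number such that W is a product of N conjugates of r^{±1} in F(A). Then there exist positions 0 ≤ v_1 < v_2 ≤ |W| and an integer ℓ with |ℓ| ≤ (|W|_{a_1} + (|n_1| + |n_2|)N)/2 such that, writing W ≡ p_1p_2p_3 with p_2 = W(v_1..v_2] the subword occupying positions v_1+1, ..., v_2, one has p_2 = a_1^ℓ in G_3 and min(|p_2|_{\bar a_1}, |p_1|_{\bar a_1} + |p_3|_{\bar a_1}) ≥ |W|_{\bar a_1}/3. [group-theoretic content of Lemma 6.3] -/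
namespace Stmt8

/-- Words over the alphabet `A^{±1}` where `A = {a_1, a_2, ..., a_{m+2}}` (at least two
generators; `a_1` is the letter `0` and `a_2` is the letter `1`). -/
abbrev Word (m : ℕ) := List (Fin (m + 2) × Bool)

/-- The image of a word in the free group `F(A)`. -/
def evalW {m : ℕ} (w : Word m) : FreeGroup (Fin (m + 2)) := FreeGroup.mk w

/-- The generator `a_1` as an element of `F(A)`. -/
def a1g (m : ℕ) : FreeGroup (Fin (m + 2)) := FreeGroup.of 0

/-- The Baumslag–Solitar relator `r = a_2 a_1^{n_1} a_2^{-1} a_1^{-n_2}` of the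
presentation (1.4). -/
def relBS (m : ℕ) (n1 n2 : ℤ) : FreeGroup (Fin (m + 2)) :=
  FreeGroup.of 1 * FreeGroup.of 0 ^ n1 * (FreeGroup.of 1)⁻¹ * FreeGroup.of 0 ^ (-n2)

/-- `g` is a product of exactly `n` conjugates of elements of `R ∪ R⁻¹`. -/
def IsProdConj {G : Type*} [Group G] (R : Set G) (n : ℕ) (g : G) : Prop :=
  ∃ r s : Fin n → G,
    (∀ i, r i ∈ R ∨ (r i)⁻¹ ∈ R) ∧
    g = (List.ofFn fun i => s i * r i * (s i)⁻¹).prod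

/-- `|U|_{a_1}`: the number of occurrences of `a_1^{±1}` in `U`. -/
def countA1 {m : ℕ} (U : Word m) : ℕ := U.countP fun x => decide (x.1 = (0 : Fin (m + 2)))

/-- `|U|_{\bar a_1} := |U| - |U|_{a_1}`. -/
def noA1 {m : ℕ} (U : Word m) : ℕ := U.countP fun x => decide (x.1 ≠ (0 : Fin (m + 2)))

abbrev Letter (m : ℕ) := Fin (m + 2) × Bool

/-- formal inverse of a letter -/
def linv {m : ℕ} (x : Letter m) : Letter m := (x.1, !x.2)

theorem linv_linv {m : ℕ} (x : Letter m) : linv (linv x) = x := by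
  simp [linv]

def BRel {m : ℕ} (n1 n2 : ℤ) (x : Letter m) (l l' : ℤ) (d : ℕ) : Prop :=
  x.1 ≠ 0 ∧ ((x.1 = 1 ∧ ∃ k : ℤ, |k| ≤ d ∧ l = (if x.2 then n1 else n2) * k ∧
    l' = (if x.2 then n2 else n1) * k) ∨ (x.1 ≠ 1 ∧ l = 0 ∧ l' = 0))

theorem BRel.symm {m : ℕ} {n1 n2 : ℤ} {x : Letter m} {l l' : ℤ} {d : ℕ}
    (h : BRel n1 n2 x l l' d) : BRel n1 n2 (linv x) l' l d := by
  obtain ⟨i, b⟩ := x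
  obtain ⟨h0, ⟨h1, k, hk, hl, hl'⟩ | ⟨h1, hl, hl'⟩⟩ := h
  · refine ⟨h0, Or.inl ⟨h1, k, hk, ?_, ?_⟩⟩ <;> cases b <;> simp_all [linv]
  · exact ⟨h0, Or.inr ⟨h1, hl', hl⟩⟩

theorem BRel.add {m : ℕ} {n1 n2 : ℤ} {x : Letter m} {l l' q q' : ℤ} {d e : ℕ}
    (h : BRel n1 n2 x l l' d) (h2 : BRel n1 n2 x q q' e) :
    BRel n1 n2 x (l + q) (l' + q') (d + e) := by
  obtain ⟨h0, ⟨h1, k, hk, hl, hl'⟩ | ⟨h1, hl, hl'⟩⟩ := h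
  · obtain ⟨_, ⟨_, j, hj, hq, hq'⟩ | ⟨h1', _⟩⟩ := h2
    · refine ⟨h0, Or.inl ⟨h1, k + j, ?_, ?_, ?_⟩⟩
      · push_cast; exact (abs_add_le _ _).trans (add_le_add hk hj)
      · rw [hl, hq]; ring
      · rw [hl', hq']; ring
    · exact absurd h1 h1'
  · obtain ⟨_, ⟨h1', _⟩ | ⟨_, hq, hq'⟩⟩ := h2
    · exact absurd h1' h1
    · exact ⟨h0, Or.inr ⟨h1, by simp [hl, hq], by simp [hl', hq']⟩⟩

theorem BRel.neg {m : ℕ} {n1 n2 : ℤ} {x : Letter m} {l l' : ℤ} {d : ℕ}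
    (h : BRel n1 n2 x l l' d) : BRel n1 n2 x (-l) (-l') d := by
  obtain ⟨h0, ⟨h1, k, hk, hl, hl'⟩ | ⟨h1, hl, hl'⟩⟩ := h
  · exact ⟨h0, Or.inl ⟨h1, -k, by simpa using hk, by rw [hl]; ring, by rw [hl']; ring⟩⟩
  · exact ⟨h0, Or.inr ⟨h1, by simp [hl], by simp [hl']⟩⟩

theorem BRel.zero {m : ℕ} {n1 n2 : ℤ} (hn1 : n1 ≠ 0) (hn2 : n2 ≠ 0) {x : Letter m} {l' : ℤ}
    {d : ℕ} (h : BRel n1 n2 x 0 l' d) : l' = 0 := by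
  obtain ⟨h0, ⟨h1, k, hk, hl, hl'⟩ | ⟨h1, hl, hl'⟩⟩ := h
  · have : k = 0 := by
      rcases zero_eq_mul.mp hl with h | h
      · split_ifs at h <;> contradiction
      · exact h
    simp [hl', this]
  · exact hl'

theorem BRel.bound {m : ℕ} {n1 n2 : ℤ} {x : Letter m} {l l' : ℤ} {d : ℕ}
    (h : BRel n1 n2 x l l' d) : |l| + |l'| ≤ (|n1| + |n2|) * d := by
  have a1 := abs_nonneg n1
  have a2 := abs_nonneg n2
  obtain ⟨h0, ⟨h1, k, hk, hl, hl'⟩ | ⟨h1, hl, hl'⟩⟩ := h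
  · have : |l| + |l'| = (|n1| + |n2|) * |k| := by
      rw [hl, hl', abs_mul, abs_mul]
      split_ifs <;> ring
    rw [this]
    exact mul_le_mul_of_nonneg_left hk (by positivity)
  · rw [hl, hl']; simp; positivity

def sg (b : Bool) : ℤ := if b then 1 else -1

/-- Band structures: `T w l c` says that `w = a_1^l` through non-crossing bands with `≤ c` cells. -/
inductive T {m : ℕ} (n1 n2 : ℤ) : Word m → ℤ → ℕ → Prop
  | nil (c : ℕ) : T n1 n2 [] 0 c
  | a1 (b : Bool) (w : Word m) (l : ℤ) (c : ℕ) (h : T n1 n2 w l c) :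
      T n1 n2 (((0 : Fin (m + 2)), b) :: w) (sg b + l) c
  | blk (x : Letter m) (u v : Word m) (l l' l2 : ℤ) (c1 c2 d c : ℕ) (hu : T n1 n2 u l c1)
      (hr : BRel n1 n2 x l l' d) (hv : T n1 n2 v l2 c2) (hc : c1 + c2 + d ≤ c) :
      T n1 n2 (x :: (u ++ linv x :: v)) (l' + l2) c

theorem T.cast {m : ℕ} {n1 n2 : ℤ} {w w' : Word m} {l l' : ℤ} {c : ℕ} (h : T n1 n2 w l c)
    (hw : w = w') (hl : l = l') : T n1 n2 w' l' c := by subst hw hl; exact h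

theorem T.mono {m : ℕ} {n1 n2 : ℤ} {w : Word m} {l : ℤ} {c c' : ℕ} (h : T n1 n2 w l c)
    (hc : c ≤ c') : T n1 n2 w l c' := by
  induction h with
  | nil c => exact T.nil _
  | a1 b w l c h ih => exact T.a1 _ _ _ _ (ih hc)
  | blk x u v l l' l2 c1 c2 d c hu hr hv h ih1 ih2 =>
    exact T.blk x u v l l' l2 c1 c2 d _ hu hr hv (h.trans hc)

theorem T.append {m : ℕ} {n1 n2 : ℤ} {w v : Word m} {l l' : ℤ} {c c' : ℕ} (h : T n1 n2 w l c)
    (h' : T n1 n2 v l' c') : T n1 n2 (w ++ v) (l + l') (c + c') := by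
  induction h with
  | nil c => exact (h'.mono (by omega)).cast (by simp) (by simp)
  | a1 b w l c h ih => exact (T.a1 b _ _ _ ih).cast (by simp) (by ring)
  | blk x u w l l1 l2 c1 c2 d c hu hr hv h ih1 ih2 =>
    exact (T.blk x u _ l l1 _ c1 _ d (c + c') hu hr ih2 (by omega)).cast (by simp) (by ring)

theorem T.nil_inv {m : ℕ} {n1 n2 : ℤ} {l : ℤ} {c : ℕ} (h : T n1 n2 ([] : Word m) l c) : l = 0 := by
  cases h; rfl

theorem T.cons_a1_inv {m : ℕ} {n1 n2 : ℤ} {b : Bool} {w : Word m} {l : ℤ} {c : ℕ}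
    (h : T n1 n2 (((0 : Fin (m + 2)), b) :: w) l c) : T n1 n2 w (l - sg b) c := by
  cases h with
  | a1 b w l c h => exact h.cast rfl (by ring)
  | blk x u v l l' l2 c1 c2 d c hu hr hv hc => exact absurd rfl hr.1

theorem T.cons_inv {m : ℕ} {n1 n2 : ℤ} {x : Letter m} (hx : x.1 ≠ 0) {w : Word m} {l : ℤ} {c : ℕ}
    (h : T n1 n2 (x :: w) l c) : ∃ u v p p' q c1 c2 d, w = u ++ linv x :: v ∧ T n1 n2 u p c1 ∧
      BRel n1 n2 x p p' d ∧ T n1 n2 v q c2 ∧ l = p' + q ∧ c1 + c2 + d ≤ c := by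
  cases h with
  | a1 b w l c h => exact absurd rfl hx
  | blk x u v l l' l2 c1 c2 d c hu hr hv hc =>
    exact ⟨u, v, l, l', l2, c1, c2, d, rfl, hu, hr, hv, rfl, hc⟩

theorem T.snoc_inv {m : ℕ} {n1 n2 : ℤ} {x : Letter m} (hx : x.1 ≠ 0) {w : Word m} {l : ℤ} {c : ℕ}
    (h : T n1 n2 w l c) : ∀ W, w = W ++ [x] →
    ∃ u v p p' q c1 c2 d, W = u ++ linv x :: v ∧ T n1 n2 u q c1 ∧
      BRel n1 n2 (linv x) p p' d ∧ T n1 n2 v p c2 ∧ l = q + p' ∧ c1 + c2 + d ≤ c := by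
  induction h with
  | nil c => intro W h; simp at h
  | a1 b w l c h ih =>
    intro W hW
    cases W with
    | nil => simp at hW; exact absurd (by rw [← hW.1]) hx
    | cons y W =>
      simp at hW
      obtain ⟨rfl, hW⟩ := hW
      obtain ⟨u, v, p, p', q, c1, c2, d, rfl, h1, h2, h3, h4, h5⟩ := ih W hW
      exact ⟨_, v, p, p', _, c1, c2, d, rfl, T.a1 b u q c1 h1, h2, h3, by rw [h4]; ring, h5⟩
  | blk y u v l l' l2 c1 c2 d c hu hr hv hc ih1 ih2 =>
    intro W hW
    rcases List.eq_nil_or_concat v with rfl | ⟨v', z, rfl⟩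
    · have : y :: u ++ [linv y] = W ++ [x] := by simpa using hW
      obtain ⟨h1, h2⟩ := List.append_inj' this rfl
      simp at h2
      subst h2 h1
      rw [linv_linv]
      exact ⟨[], u, l, l', 0, 0, c1, d, rfl, T.nil 0, hr, hu, by rw [hv.nil_inv]; ring, by omega⟩
    · have : (y :: u ++ linv y :: v') ++ [z] = W ++ [x] := by simpa using hW
      obtain ⟨h1, h2⟩ := List.append_inj' this rfl
      simp at h2
      subst h2 h1
      obtain ⟨u1, v1, p, p', q, e1, e2, e, rfl, g1, g2, g3, g4, g5⟩ := ih2 v' (by simp)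
      exact ⟨y :: (u ++ linv y :: u1), v1, p, p', l' + q, c1 + e1 + d, e2, e, by simp,
        T.blk y u u1 l l' q c1 e1 d _ hu hr g1 le_rfl, g2, g3, by rw [g4]; ring, by omega⟩

theorem T.cancel {m : ℕ} {n1 n2 : ℤ} (hn1 : n1 ≠ 0) (hn2 : n2 ≠ 0) {w : Word m} {l : ℤ} {c : ℕ}
    (h : T n1 n2 w l c) : ∀ (u v : Word m) (x : Letter m), w = u ++ x :: linv x :: v →
    T n1 n2 (u ++ v) l c := by
  induction h with
  | nil c => intro u v x h; simp at h
  | a1 b w l c h ih =>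
    intro u v x hw
    cases u with
    | nil =>
      simp at hw
      obtain ⟨rfl, rfl⟩ := hw
      refine (T.cons_a1_inv h).cast rfl ?_
      cases b <;> simp [sg] <;> ring
    | cons y u =>
      simp at hw
      obtain ⟨rfl, hw⟩ := hw
      exact T.a1 b _ _ _ (ih u v x hw)
  | blk y U V l l' l2 c1 c2 d c hu hr hv hc ih1 ih2 =>
    intro u v x hw
    cases u with
    | nil =>
      simp only [List.nil_append, List.cons.injEq] at hw
      obtain ⟨rfl, hw⟩ := hw
      cases U with
      | nil =>
        simp at hw
        subst hw
        have h0 := hu.nil_inv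
        subst h0
        have := hr.zero hn1 hn2
        subst this
        exact (hv.mono (by omega)).cast rfl (by ring)
      | cons z U =>
        simp only [List.cons_append, List.cons.injEq] at hw
        obtain ⟨rfl, rfl⟩ := hw
        obtain ⟨u1, u2, p, p', q, e1, e2, e, rfl, g1, g2, g3, g4, g5⟩ :=
          T.cons_inv (x := linv y) hr.1 hu
        have g2' := g2.symm
        rw [linv_linv] at g2'
        have hr' := hr.add g2'.neg
        have := g1.append (T.blk y u2 V q (l' + -p) l2 e2 c2 (d + e) (e2 + c2 + (d + e)) g3
          (by rw [g4] at hr'; convert hr' using 1; ring) hv le_rfl)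
        exact (this.mono (by omega)).cast (by simp [linv_linv]) (by ring)
    | cons z u =>
      simp only [List.cons_append, List.cons.injEq] at hw
      obtain ⟨rfl, hw⟩ := hw
      rcases List.append_eq_append_iff.mp hw with ⟨a, h1, h2⟩ | ⟨a, h1, h2⟩
      · -- u = U ++ a
        cases a with
        | nil =>
          simp at h1 h2
          subst h1
          obtain ⟨h2, h3⟩ := h2
          subst h2 h3
          rw [linv_linv] at hv
          obtain ⟨u1, u2, p, p', q, e1, e2, e, rfl, g1, g2, g3, g4, g5⟩ :=
            T.cons_inv hr.1 hv
          have := T.blk y (u ++ u1) u2 (l + p) (l' + p') q (c1 + e1) e2 (d + e) c (hu.append g1)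
            (hr.add g2) g3 (by omega)
          exact this.cast (by simp) (by rw [g4]; ring)
        | cons b a =>
          simp at h2
          obtain ⟨rfl, h2⟩ := h2
          subst h1
          have := T.blk y U _ l l' l2 c1 c2 d c hu hr (ih2 _ _ _ h2) hc
          exact this.cast (by simp) rfl
      · -- U = u ++ a
        cases a with
        | nil =>
          simp at h1 h2
          subst h1
          obtain ⟨h2, h3⟩ := h2
          subst h2 h3
          rw [linv_linv] at hv
          obtain ⟨u1, u2, p, p', q, e1, e2, e, rfl, g1, g2, g3, g4, g5⟩ :=
            T.cons_inv hr.1 hv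
          have := T.blk y (U ++ u1) u2 (l + p) (l' + p') q (c1 + e1) e2 (d + e) c (hu.append g1)
            (hr.add g2) g3 (by omega)
          exact this.cast (by simp) (by rw [g4]; ring)
        | cons b a =>
          simp at h2
          obtain ⟨rfl, h2⟩ := h2
          cases a with
          | nil =>
            simp at h2
            obtain ⟨h2, rfl⟩ := h2
            have hxy : y = x := by
              have := congrArg linv h2
              simpa [linv_linv] using this.symm
            subst hxy
            obtain ⟨u1, u2, p, p', q, e1, e2, e, rfl, g1, g2, g3, g4, g5⟩ :=
              T.snoc_inv hr.1 hu u h1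
            -- y u1 y⁻¹ u2 v
            have g2' := g2.symm
            rw [linv_linv] at g2'
            have hr' := hr.add g2'.neg
            have := T.blk y u1 (u2 ++ v) q (l' + -p) (p + l2) e1 (e2 + c2) (d + e) c g1
              (by rw [g4] at hr'; convert hr' using 1; ring) (g3.append hv) (by omega)
            exact this.cast (by simp) (by ring)
          | cons b a =>
            simp at h2
            obtain ⟨rfl, rfl⟩ := h2
            have := T.blk y _ V l l' l2 c1 c2 d c (ih1 _ _ _ h1) hr hv hc
            exact this.cast (by simp) rfl

theorem T.pair {m : ℕ} {n1 n2 : ℤ} (x : Letter m) (c : ℕ) : T n1 n2 [x, linv x] 0 c := by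
  by_cases hx : x.1 = 0
  · obtain ⟨i, b⟩ := x
    simp at hx
    subst hx
    refine (T.a1 b _ _ _ (T.a1 (!b) _ _ _ (T.nil c))).cast rfl ?_
    cases b <;> simp [sg]
  · refine (T.blk x [] [] 0 0 0 0 0 0 c (T.nil _) ⟨hx, ?_⟩ (T.nil _) (by omega)).cast rfl rfl
    by_cases h1 : x.1 = 1
    · exact Or.inl ⟨h1, 0, by simp, by simp, by simp⟩
    · exact Or.inr ⟨h1, rfl, rfl⟩

/-- splitting of a concatenation is impossible in general, so insertion is done by induction -/
theorem T.insert {m : ℕ} {n1 n2 : ℤ} {w : Word m} {l : ℤ} {c : ℕ}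
    (h : T n1 n2 w l c) : ∀ (u v : Word m) (x : Letter m), w = u ++ v →
    T n1 n2 (u ++ x :: linv x :: v) l c := by
  induction h with
  | nil c =>
    intro u v x h
    obtain ⟨rfl, rfl⟩ := List.append_eq_nil_iff.mp h.symm
    exact T.pair x c
  | a1 b w l c h ih =>
    intro u v x hw
    cases u with
    | nil =>
      simp at hw
      subst hw
      exact ((T.pair x 0).append (T.a1 b w l c h)).cast (by simp) (by ring) |>.mono (by omega)
    | cons y u =>
      simp at hw
      obtain ⟨rfl, hw⟩ := hw
      exact T.a1 b _ _ _ (ih u v x hw)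
  | blk y U V l l' l2 c1 c2 d c hu hr hv hc ih1 ih2 =>
    intro u v x hw
    cases u with
    | nil =>
      simp at hw
      subst hw
      exact ((T.pair x 0).append (T.blk y U V l l' l2 c1 c2 d c hu hr hv hc)).cast
        (by simp) (by ring) |>.mono (by omega)
    | cons z u =>
      simp only [List.cons_append, List.cons.injEq] at hw
      obtain ⟨rfl, hw⟩ := hw
      rcases List.append_eq_append_iff.mp hw with ⟨a, h1, h2⟩ | ⟨a, h1, h2⟩
      · cases a with
        | nil =>
          simp at h1 h2
          subst h1 h2
          have := T.blk y _ V l l' l2 c1 c2 d c (ih1 u [] x (by simp)) hr hv hc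
          exact this.cast (by simp) rfl
        | cons b a =>
          simp at h2
          obtain ⟨rfl, h2⟩ := h2
          subst h1
          have := T.blk y U _ l l' l2 c1 c2 d c hu hr (ih2 _ _ x h2) hc
          exact this.cast (by simp) rfl
      · have := T.blk y _ V l l' l2 c1 c2 d c (ih1 u a x h1) hr hv hc
        exact this.cast (by simp [h2]) rfl

theorem T.red {m : ℕ} {n1 n2 : ℤ} (hn1 : n1 ≠ 0) (hn2 : n2 ≠ 0) {w w' : Word m} {l : ℤ} {c : ℕ}
    (h : FreeGroup.Red w w') : T n1 n2 w l c ↔ T n1 n2 w' l c := by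
  induction h with
  | refl => rfl
  | tail _ hs ih =>
    rw [ih]
    cases hs with
    | not => exact ⟨fun h => h.cancel hn1 hn2 _ _ _ rfl, fun h => h.insert _ _ (_, _) rfl⟩

theorem T.congr {m : ℕ} {n1 n2 : ℤ} (hn1 : n1 ≠ 0) (hn2 : n2 ≠ 0) {w w' : Word m} {l : ℤ} {c : ℕ}
    (h : FreeGroup.mk w = FreeGroup.mk w') (hT : T n1 n2 w l c) : T n1 n2 w' l c := by
  obtain ⟨z, h1, h2⟩ := FreeGroup.Red.exact.mp h
  exact (T.red hn1 hn2 h2).mpr ((T.red hn1 hn2 h1).mp hT)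

def TG {m : ℕ} (n1 n2 : ℤ) (g : FreeGroup (Fin (m + 2))) (l : ℤ) (c : ℕ) : Prop :=
  ∃ w : Word m, FreeGroup.mk w = g ∧ T n1 n2 w l c

theorem TG.mul {m : ℕ} {n1 n2 : ℤ} {g h : FreeGroup (Fin (m + 2))} {l l' : ℤ} {c c' : ℕ}
    (hg : TG n1 n2 g l c) (hh : TG n1 n2 h l' c') : TG n1 n2 (g * h) (l + l') (c + c') := by
  obtain ⟨w, rfl, hw⟩ := hg
  obtain ⟨v, rfl, hv⟩ := hh
  exact ⟨w ++ v, by simp, hw.append hv⟩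

theorem TG.conj {m : ℕ} {n1 n2 : ℤ} {g : FreeGroup (Fin (m + 2))} {l l' : ℤ} {c d : ℕ}
    (x : Letter m) (hg : TG n1 n2 g l c) (hr : BRel n1 n2 x l l' d) :
    TG n1 n2 (FreeGroup.mk [x] * g * (FreeGroup.mk [x])⁻¹) l' (c + d) := by
  obtain ⟨w, rfl, hw⟩ := hg
  exact ⟨x :: (w ++ linv x :: []), by simp [FreeGroup.invRev, linv],
    (T.blk x w [] l l' 0 c 0 d (c + d) hw hr (T.nil 0) (by omega)).cast rfl (by ring)⟩

theorem TG.one {m : ℕ} {n1 n2 : ℤ} : TG n1 n2 (1 : FreeGroup (Fin (m + 2))) 0 0 :=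
  ⟨[], rfl, T.nil 0⟩

theorem TG.pow {m : ℕ} {n1 n2 : ℤ} (k : ℤ) :
    TG n1 n2 ((FreeGroup.of 0 : FreeGroup (Fin (m + 2))) ^ k) k 0 := by
  have hp : ∀ b, TG n1 n2 (FreeGroup.mk [((0 : Fin (m + 2)), b)]) (sg b) 0 := fun b =>
    ⟨_, rfl, (T.a1 b [] 0 0 (T.nil 0)).cast rfl (by ring)⟩
  induction k using Int.induction_on with
  | zero => simpa using TG.one
  | succ i ih =>
    rw [zpow_add_one]
    exact ih.mul (hp true)
  | pred i ih =>
    rw [zpow_sub_one]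
    exact ih.mul (hp false)

theorem TG.conj_zero {m : ℕ} {n1 n2 : ℤ} {g : FreeGroup (Fin (m + 2))} {c : ℕ}
    (s : FreeGroup (Fin (m + 2))) (hg : TG n1 n2 g 0 c) : TG n1 n2 (s * g * s⁻¹) 0 c := by
  have key : ∀ (w : Word m), TG n1 n2 (FreeGroup.mk w * g * (FreeGroup.mk w)⁻¹) 0 c := by
    intro w
    induction w with
    | nil => simpa [← FreeGroup.one_eq_mk] using hg
    | cons x w ih =>
      have : FreeGroup.mk (x :: w) * g * (FreeGroup.mk (x :: w))⁻¹ =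
          FreeGroup.mk [x] * (FreeGroup.mk w * g * (FreeGroup.mk w)⁻¹) * (FreeGroup.mk [x])⁻¹ := by
        have : FreeGroup.mk (x :: w) = FreeGroup.mk [x] * FreeGroup.mk w := by simp
        rw [this]; group
      rw [this]
      obtain ⟨v, hv, hT⟩ := ih
      rw [← hv]
      by_cases hx : x.1 = 0
      · obtain ⟨i, b⟩ := x
        simp at hx
        subst hx
        refine ⟨(0, b) :: (v ++ [(0, !b)]), by simp [FreeGroup.invRev], ?_⟩
        refine (T.a1 b _ _ _ (hT.append (T.a1 (!b) [] 0 0 (T.nil 0)))).cast rfl ?_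
        cases b <;> simp [sg]
      · refine TG.conj (d := 0) x ⟨v, rfl, hT⟩ ⟨hx, ?_⟩
        by_cases h1 : x.1 = 1
        · exact Or.inl ⟨h1, 0, by simp, by simp, by simp⟩
        · exact Or.inr ⟨h1, rfl, rfl⟩
  have := key s.toWord
  rwa [FreeGroup.mk_toWord] at this

theorem TG.rel {m : ℕ} {n1 n2 : ℤ} : TG n1 n2 (relBS m n1 n2) 0 1 := by
  have h1 : BRel n1 n2 (((1 : Fin (m + 2)), true)) n1 n2 1 :=
    ⟨by simp, Or.inl ⟨rfl, 1, by simp, by simp, by simp⟩⟩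
  have := ((TG.pow (m := m) (n1 := n1) (n2 := n2) n1).conj _ h1).mul (TG.pow (-n2))
  simp only [add_neg_cancel, zero_add, add_zero] at this
  exact this

theorem TG.rel_inv {m : ℕ} {n1 n2 : ℤ} : TG n1 n2 (relBS m n1 n2)⁻¹ 0 1 := by
  have h1 : BRel n1 n2 (((1 : Fin (m + 2)), true)) (-n1) (-n2) 1 :=
    ⟨by simp, Or.inl ⟨rfl, -1, by simp, by simp, by simp⟩⟩
  have := (TG.pow (m := m) (n1 := n1) (n2 := n2) n2).mul ((TG.pow (-n1)).conj _ h1)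
  have e : (relBS m n1 n2)⁻¹ = FreeGroup.of 0 ^ n2 * (FreeGroup.mk [(1, true)] *
      FreeGroup.of 0 ^ (-n1) * (FreeGroup.mk [(1, true)])⁻¹) := by
    change (FreeGroup.of 1 * FreeGroup.of 0 ^ n1 * (FreeGroup.of 1)⁻¹ * FreeGroup.of 0 ^ (-n2))⁻¹
      = FreeGroup.of 0 ^ n2 * (FreeGroup.of 1 * FreeGroup.of 0 ^ (-n1) * (FreeGroup.of 1)⁻¹)
    group
  rw [e]
  simpa using this

theorem TG.prod {m : ℕ} {n1 n2 : ℤ} (L : List (FreeGroup (Fin (m + 2))))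
    (h : ∀ g ∈ L, TG n1 n2 g 0 1) : TG n1 n2 L.prod 0 L.length := by
  induction L with
  | nil => exact TG.one
  | cons g L ih =>
    have := (h g (by simp)).mul (ih fun g hg => h g (by simp [hg]))
    simpa [add_comm] using this

theorem T.of_prod {m : ℕ} {n1 n2 : ℤ} (hn1 : n1 ≠ 0) (hn2 : n2 ≠ 0) {W : Word m} {N : ℕ}
    (hN : IsProdConj {relBS m n1 n2} N (evalW W)) : T n1 n2 W 0 N := by
  obtain ⟨r, s, hr, he⟩ := hN
  have := TG.prod (n1 := n1) (n2 := n2) (List.ofFn fun i => s i * r i * (s i)⁻¹) (by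
    intro g hg
    obtain ⟨i, rfl⟩ := (List.mem_ofFn' _ _).mp hg
    apply TG.conj_zero
    rcases hr i with h | h
    · rw [Set.mem_singleton_iff] at h
      rw [h]; exact TG.rel
    · rw [Set.mem_singleton_iff] at h
      rw [← inv_inv (r i), h]; exact TG.rel_inv)
  rw [← he, List.length_ofFn] at this
  obtain ⟨w, hw, hT⟩ := this
  exact hT.congr hn1 hn2 hw

theorem noA1_nil {m : ℕ} : noA1 ([] : Word m) = 0 := rfl

theorem noA1_append {m : ℕ} (u v : Word m) : noA1 (u ++ v) = noA1 u + noA1 v := by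
  simp [noA1]
theorem countA1_append {m : ℕ} (u v : Word m) : countA1 (u ++ v) = countA1 u + countA1 v := by
  simp [countA1]
theorem noA1_cons0 {m : ℕ} (b : Bool) (v : Word m) : noA1 ((0, b) :: v) = noA1 v := by
  simp [noA1]
theorem countA1_cons0 {m : ℕ} (b : Bool) (v : Word m) :
    countA1 ((0, b) :: v) = countA1 v + 1 := by
  simp [countA1]
theorem noA1_blk {m : ℕ} (x : Letter m) (hx : x.1 ≠ 0) (u v : Word m) :
    noA1 (x :: (u ++ linv x :: v)) = noA1 u + noA1 v + 2 := by
  simp [noA1, hx, linv]; omega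
theorem countA1_blk {m : ℕ} (x : Letter m) (hx : x.1 ≠ 0) (u v : Word m) :
    countA1 (x :: (u ++ linv x :: v)) = countA1 u + countA1 v := by
  simp [countA1, hx, linv]

theorem T.even {m : ℕ} {n1 n2 : ℤ} {w : Word m} {l : ℤ} {c : ℕ} (h : T n1 n2 w l c) :
    noA1 w % 2 = 0 := by
  induction h with
  | nil c => simp [noA1]
  | a1 b w l c h ih => rwa [noA1_cons0]
  | blk x u v l l' l2 c1 c2 d c hu hr hv hc ih1 ih2 => rw [noA1_blk x hr.1]; omega

theorem abs_sg (b : Bool) : |sg b| = 1 := by cases b <;> simp [sg]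

theorem cost_le {n1 n2 : ℤ} {c1 c2 d c : ℕ} (hc : c1 + c2 + d ≤ c) :
    (|n1| + |n2|) * (c1 : ℤ) + (|n1| + |n2|) * (c2 : ℤ) + (|n1| + |n2|) * (d : ℤ) ≤
      (|n1| + |n2|) * (c : ℤ) := by
  rw [← mul_add, ← mul_add]
  exact mul_le_mul_of_nonneg_left (by exact_mod_cast hc) (by positivity)

theorem T.abs_le {m : ℕ} {n1 n2 : ℤ} {w : Word m} {l : ℤ} {c : ℕ} (h : T n1 n2 w l c) :
    |l| ≤ countA1 w + (|n1| + |n2|) * c := by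
  induction h with
  | nil c => simp; positivity
  | a1 b w l c h ih =>
    rw [countA1_cons0]
    have := abs_add_le (sg b) l
    rw [abs_sg] at this
    push_cast; linarith
  | blk x u v l l' l2 c1 c2 d c hu hr hv hc ih1 ih2 =>
    rw [countA1_blk x hr.1]
    have := abs_add_le l' l2
    have h1 := hr.bound
    have h2 := cost_le (n1 := n1) (n2 := n2) hc
    have := abs_nonneg l
    push_cast; linarith

/-- value in the quotient group -/
def qv {m : ℕ} (n1 n2 : ℤ) (w : Word m) :
    FreeGroup (Fin (m + 2)) ⧸ Subgroup.normalClosure {relBS m n1 n2} :=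
  QuotientGroup.mk (evalW w)

theorem qv_append {m : ℕ} {n1 n2 : ℤ} (u v : Word m) :
    qv n1 n2 (u ++ v) = qv n1 n2 u * qv n1 n2 v := by
  simp only [qv, evalW, ← FreeGroup.mul_mk]; rfl

def qa {m : ℕ} (n1 n2 : ℤ) :
    FreeGroup (Fin (m + 2)) ⧸ Subgroup.normalClosure {relBS m n1 n2} :=
  QuotientGroup.mk (a1g m)

theorem qv_a1 {m : ℕ} {n1 n2 : ℤ} (b : Bool) :
    qv n1 n2 [((0 : Fin (m + 2)), b)] = qa n1 n2 ^ sg b := by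
  cases b
  · simp only [sg, Bool.false_eq_true, if_false, zpow_neg_one]; rfl
  · simp only [sg, if_true, zpow_one]; rfl

theorem qv_linv {m : ℕ} {n1 n2 : ℤ} (x : Letter m) :
    qv n1 n2 [linv x] = (qv n1 n2 [x])⁻¹ := by
  rfl

theorem qv_rel {m : ℕ} {n1 n2 : ℤ} : qv n1 n2 [((1 : Fin (m + 2)), true)] * qa n1 n2 ^ n1 *
    (qv n1 n2 [((1 : Fin (m + 2)), true)])⁻¹ = qa n1 n2 ^ n2 := by
  have h : (QuotientGroup.mk (relBS m n1 n2) :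
    FreeGroup (Fin (m + 2)) ⧸ Subgroup.normalClosure {relBS m n1 n2}) = 1 :=
    (QuotientGroup.eq_one_iff _).mpr (Subgroup.subset_normalClosure rfl)
  have h2 : qv n1 n2 [((1 : Fin (m + 2)), true)] * qa n1 n2 ^ n1 *
    (qv n1 n2 [((1 : Fin (m + 2)), true)])⁻¹ * qa n1 n2 ^ (-n2) = 1 := h
  rw [zpow_neg] at h2
  exact mul_inv_eq_one.mp h2

theorem qv_conj {m : ℕ} {n1 n2 : ℤ} {x : Letter m} {l l' : ℤ} {d : ℕ}
    (h : BRel n1 n2 x l l' d) :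
    qv n1 n2 [x] * qa n1 n2 ^ l * (qv n1 n2 [x])⁻¹ = qa n1 n2 ^ l' := by
  obtain ⟨i, b⟩ := x
  obtain ⟨h0, ⟨h1, k, hk, hl, hl'⟩ | ⟨h1, hl, hl'⟩⟩ := h
  · simp only at h1
    subst h1
    cases b
    · simp at hl hl'
      have e : qv n1 n2 [((1 : Fin (m + 2)), false)] = (qv n1 n2 [((1 : Fin (m + 2)), true)])⁻¹ :=
        qv_linv ((1 : Fin (m + 2)), true)
      rw [e, hl, hl', zpow_mul, zpow_mul, ← qv_rel, conj_zpow]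
      group
    · simp at hl hl'
      rw [hl, hl', zpow_mul, zpow_mul, ← qv_rel, conj_zpow]
  · rw [hl, hl']; simp

theorem qv_blk {m : ℕ} {n1 n2 : ℤ} {x : Letter m} {u : Word m} {l l' : ℤ} {d : ℕ}
    (h : BRel n1 n2 x l l' d) (hu : qv n1 n2 u = qa n1 n2 ^ l) :
    qv n1 n2 (x :: (u ++ [linv x])) = qa n1 n2 ^ l' := by
  have : x :: (u ++ [linv x]) = [x] ++ u ++ [linv x] := by simp
  rw [this, qv_append, qv_append, hu, qv_linv, qv_conj h]

theorem T.qv_eq {m : ℕ} {n1 n2 : ℤ} {w : Word m} {l : ℤ} {c : ℕ} (h : T n1 n2 w l c) :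
    qv n1 n2 w = qa n1 n2 ^ l := by
  induction h with
  | nil c => simp; rfl
  | a1 b w l c h ih =>
    rw [zpow_add, ← ih, ← qv_a1, ← qv_append]; rfl
  | blk x u v l l' l2 c1 c2 d c hu hr hv hc ih1 ih2 =>
    rw [zpow_add, ← ih2, ← qv_blk hr ih1, ← qv_append]; simp

def Good {m : ℕ} (n1 n2 : ℤ) (W : Word m) (B : ℤ) : Prop :=
  ∃ P p S : Word m, W = P ++ p ++ S ∧ ∃ ℓ : ℤ, 2 * |ℓ| ≤ B ∧ qv n1 n2 p = qa n1 n2 ^ ℓ ∧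
    noA1 W ≤ 3 * noA1 p ∧ 3 * noA1 p ≤ 2 * noA1 W

theorem T.good {m : ℕ} {n1 n2 : ℤ} {W : Word m} {B : ℤ} (hW2 : 2 < noA1 W)
    (hWe : noA1 W % 2 = 0) {U : Word m} {l : ℤ} {c : ℕ} (h : T n1 n2 U l c) :
    ∀ (P Q S : Word m) (q : ℤ), W = P ++ Q ++ U ++ S → qv n1 n2 Q = qa n1 n2 ^ q →
      3 * noA1 Q < noA1 W → noA1 W ≤ 3 * (noA1 Q + noA1 U) →
      |q| + |q + l| + (countA1 U + (|n1| + |n2|) * c) ≤ B → Good n1 n2 W B := by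
  induction h with
  | nil c =>
    intro P Q S q hW hq h1 h2 hB
    simp [noA1] at h1 h2
    omega
  | a1 b w l c h ih =>
    intro P Q S q hW hq h1 h2 hB
    refine ih P (Q ++ [(0, b)]) S (q + sg b) (by simp [hW]) ?_ ?_ ?_ ?_
    · rw [qv_append, hq, qv_a1, zpow_add]
    · rw [noA1_append, noA1_cons0]; exact h1
    · rw [noA1_append, noA1_cons0]; rw [noA1_cons0] at h2; exact h2
    · rw [countA1_cons0] at hB
      have := abs_add_le q (sg b)
      rw [abs_sg] at this
      push_cast at hB
      rw [← add_assoc q (sg b) l] at hB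
      linarith
  | blk x u v l l' l2 c1 c2 d c hu hr hv hc ih1 ih2 =>
    intro P Q S q hW hq h1 h2 hB
    have hb := hr.bound
    have hcost := cost_le (n1 := n1) (n2 := n2) hc
    have hqb := qv_blk hr hu.qv_eq
    have hue := hu.even
    have hua := hu.abs_le
    have hva := hv.abs_le
    have hblk : noA1 (x :: (u ++ [linv x])) = noA1 u + 2 := by
      rw [noA1_blk x hr.1]; simp [noA1]
    rw [countA1_blk x hr.1] at hB
    rw [noA1_blk x hr.1] at h2
    push_cast at hB
    have a1 := abs_nonneg l
    have a2 := abs_nonneg q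
    have a3 := abs_nonneg (q + (l' + l2))
    have a4 : (0 : ℤ) ≤ (countA1 u : ℤ) := by positivity
    have a5 : (0 : ℤ) ≤ (|n1| + |n2|) * (c1 : ℤ) := by positivity
    have a6 : (0 : ℤ) ≤ (countA1 v : ℤ) := by positivity
    have a7 : (0 : ℤ) ≤ (|n1| + |n2|) * (c2 : ℤ) := by positivity
    have t1 : |q + l'| ≤ |q| + |l'| := abs_add_le _ _
    have t2 : |q + l'| ≤ |q + (l' + l2)| + |l2| := by
      have := abs_sub (q + (l' + l2)) l2
      rwa [show q + (l' + l2) - l2 = q + l' by ring] at this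
    have t3 : |l'| ≤ |q + l'| + |q| := by
      have := abs_sub (q + l') q
      rwa [show q + l' - q = l' by ring] at this
    by_cases c1 : 3 * (noA1 Q + (noA1 u + 2)) < noA1 W
    · refine ih2 P (Q ++ (x :: (u ++ [linv x]))) S (q + l') (by simp [hW]) ?_ ?_ ?_ ?_
      · rw [qv_append, hq, hqb, zpow_add]
      · rw [noA1_append, hblk]; exact c1
      · rw [noA1_append, hblk]; omega
      · rw [add_assoc q l' l2]
        linarith
    by_cases c2 : 3 * (noA1 Q + (noA1 u + 2)) ≤ 2 * noA1 W
    · refine ⟨P, Q ++ (x :: (u ++ [linv x])), v ++ S, by simp [hW], q + l', ?_, ?_, ?_, ?_⟩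
      · linarith
      · rw [qv_append, hq, hqb, zpow_add]
      · rw [noA1_append, hblk]; omega
      · rw [noA1_append, hblk]; omega
    by_cases c3 : 3 * (noA1 u + 2) ≤ 2 * noA1 W
    · refine ⟨P ++ Q, (x :: (u ++ [linv x])), v ++ S, by simp [hW], l', ?_, hqb, ?_, ?_⟩
      · linarith
      · rw [hblk]; omega
      · rw [hblk]; omega
    by_cases c4 : 3 * noA1 u ≤ 2 * noA1 W
    · refine ⟨P ++ Q ++ [x], u, linv x :: v ++ S, by simp [hW], l, ?_, hu.qv_eq, ?_, ?_⟩
      · have := abs_nonneg l'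
        linarith
      · omega
      · omega
    · refine ih1 (P ++ Q ++ [x]) [] (linv x :: v ++ S) 0 (by simp [hW]) (by simp; rfl) ?_ ?_ ?_
      · rw [noA1_nil]; omega
      · omega
      · have := abs_nonneg l'
        simp only [abs_zero, zero_add]
        linarith

/-- Group-theoretic content of Lemma 6.3: if `W = 1` in `G_3`, `|W|_{\bar a_1} > 2`, and
`N` is the minimal number such that `W` is a product of `N` conjugates of `r^{±1}` in
`F(A)`, then there exist positions `0 ≤ v_1 < v_2 ≤ |W|` and an integer `ℓ` with
`|ℓ| ≤ (|W|_{a_1} + (|n_1| + |n_2|)N)/2` such that, writing `W ≡ p_1 p_2 p_3` with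
`p_2 = W(v_1..v_2]`, one has `p_2 = a_1^ℓ` in `G_3` and
`min(|p_2|_{\bar a_1}, |p_1|_{\bar a_1} + |p_3|_{\bar a_1}) ≥ |W|_{\bar a_1}/3`. -/
theorem statement8 (m : ℕ) (n1 n2 : ℤ) (hn1 : n1 ≠ 0) (hn2 : n2 ≠ 0)
    (W : Word m)
    (hW : evalW W ∈ Subgroup.normalClosure {relBS m n1 n2})
    (hlen : 2 < noA1 W)
    (N : ℕ) (hN : IsProdConj {relBS m n1 n2} N (evalW W))
    (hNmin : ∀ k, IsProdConj {relBS m n1 n2} k (evalW W) → N ≤ k) :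
    ∃ v1 v2 : ℕ, v1 < v2 ∧ v2 ≤ W.length ∧
      ∃ ℓ : ℤ,
        2 * |ℓ| ≤ (countA1 W : ℤ) + (|n1| + |n2|) * (N : ℤ) ∧
        evalW ((W.take v2).drop v1) * (a1g m ^ ℓ)⁻¹ ∈
          Subgroup.normalClosure {relBS m n1 n2} ∧
        noA1 W ≤
          3 * min (noA1 ((W.take v2).drop v1)) (noA1 (W.take v1) + noA1 (W.drop v2)) := by
  have hT := T.of_prod hn1 hn2 hN
  obtain ⟨P, p, S, rfl, ℓ, h1, h2, h3, h4⟩ := hT.good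
    (B := (countA1 W : ℤ) + (|n1| + |n2|) * (N : ℤ)) hlen hT.even [] [] [] 0 (by simp)
    (by simp; rfl) (by rw [noA1_nil]; omega) (by omega) (by simp)
  have e1 : ((P ++ p ++ S).take (P.length + p.length)).drop P.length = p := by
    simp [List.take_append]
  have e2 : (P ++ p ++ S).take P.length = P := by simp
  have e3 : (P ++ p ++ S).drop (P.length + p.length) = S := by
    simp [List.drop_append]
  refine ⟨P.length, P.length + p.length, ?_, by simp, ℓ, h1, ?_, ?_⟩
  · rcases p with _ | ⟨x, p⟩
    · rw [noA1_nil] at h3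
      omega
    · simp
  · rw [e1, ← QuotientGroup.eq_one_iff]
    have : (QuotientGroup.mk (evalW p * (a1g m ^ ℓ)⁻¹) :
        FreeGroup (Fin (m + 2)) ⧸ Subgroup.normalClosure {relBS m n1 n2}) =
        qv n1 n2 p * (qa n1 n2 ^ ℓ)⁻¹ := rfl
    rw [this, h2, mul_inv_cancel]
  · rw [e1, e2, e3]
    simp only [noA1_append] at h3 h4 ⊢
    omega

end Stmt8
end

section
/- Let G_3 be given by presentation (1.4) with |n_1| = |n_2| = n_0 > 0. If a word W over A^{±1} satisfies W = 1 in G_3, then W is a product of at most |W|²/(4n_0) conjugates of r^{±1} in F(A), where r = a_2a_1^{n_1}a_2^{-1}a_1^{-n_2}. [group-theoretic content of Lemma 9.1: quadratic isoperimetric bound] -/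
namespace Stmt14

/-- Words over the alphabet `A^{±1}` where `A = {a_1, a_2, ..., a_{m+2}}` (at least two
generators; `a_1` is the letter `0` and `a_2` is the letter `1`). -/
abbrev Word (m : ℕ) := List (Fin (m + 2) × Bool)

/-- The image of a word in the free group `F(A)`. -/
def evalW {m : ℕ} (w : Word m) : FreeGroup (Fin (m + 2)) := FreeGroup.mk w

/-- The generator `a_1` as an element of `F(A)`. -/
def a1g (m : ℕ) : FreeGroup (Fin (m + 2)) := FreeGroup.of 0

/-- The Baumslag–Solitar relator `r = a_2 a_1^{n_1} a_2^{-1} a_1^{-n_2}` of the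
presentation (1.4). -/
def relBS (m : ℕ) (n1 n2 : ℤ) : FreeGroup (Fin (m + 2)) :=
  FreeGroup.of 1 * FreeGroup.of 0 ^ n1 * (FreeGroup.of 1)⁻¹ * FreeGroup.of 0 ^ (-n2)

/-- `g` is a product of exactly `n` conjugates of elements of `R ∪ R⁻¹`. -/
def IsProdConj {G : Type*} [Group G] (R : Set G) (n : ℕ) (g : G) : Prop :=
  ∃ r s : Fin n → G,
    (∀ i, r i ∈ R ∨ (r i)⁻¹ ∈ R) ∧
    g = (List.ofFn fun i => s i * r i * (s i)⁻¹).prod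

/-- `|U|_{a_1}`: the number of occurrences of `a_1^{±1}` in `U`. -/
def countA1 {m : ℕ} (U : Word m) : ℕ := U.countP fun x => decide (x.1 = (0 : Fin (m + 2)))

/-- `|U|_{\bar a_1} := |U| - |U|_{a_1}`. -/
def noA1 {m : ℕ} (U : Word m) : ℕ := U.countP fun x => decide (x.1 ≠ (0 : Fin (m + 2)))

/-- List version of `IsProdConj` for a single relator. -/
def PC {G : Type*} [Group G] (r : G) (n : ℕ) (g : G) : Prop :=
  ∃ L : List (G × G), L.length = n ∧ (∀ x ∈ L, x.1 = r ∨ x.1⁻¹ = r) ∧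
    g = (L.map fun x => x.2 * x.1 * x.2⁻¹).prod

lemma PC.isProdConj {G : Type*} [Group G] {r : G} {n : ℕ} {g : G} (h : PC r n g) :
    IsProdConj {r} n g := by
  obtain ⟨L, rfl, hL, rfl⟩ := h
  refine ⟨fun i => (L.get i).1, fun i => (L.get i).2, fun i => ?_, ?_⟩
  · simpa using hL _ (L.get_mem i)
  · congr 1
    conv_lhs => rw [← List.ofFn_get L, List.map_ofFn]
    rfl

lemma PC.one {G : Type*} [Group G] (r : G) : PC r 0 1 := ⟨[], by simp⟩

lemma PC.base {G : Type*} [Group G] (r : G) : PC r 1 r := ⟨[(r, 1)], by simp⟩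

lemma PC.mul {G : Type*} [Group G] {r : G} {n n' : ℕ} {g g' : G} (h : PC r n g)
    (h' : PC r n' g') : PC r (n + n') (g * g') := by
  obtain ⟨L, rfl, hL, rfl⟩ := h
  obtain ⟨L', rfl, hL', rfl⟩ := h'
  refine ⟨L ++ L', by simp, ?_, by simp⟩
  intro x hx
  rcases List.mem_append.1 hx with hx | hx
  · exact hL x hx
  · exact hL' x hx

lemma PC.conj {G : Type*} [Group G] {r : G} {n : ℕ} {g : G} (h : PC r n g) (s : G) :
    PC r n (s * g * s⁻¹) := by
  obtain ⟨L, rfl, hL, rfl⟩ := h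
  refine ⟨L.map fun x => (x.1, s * x.2), by simp, ?_, ?_⟩
  · intro x hx
    obtain ⟨y, hy, rfl⟩ := List.mem_map.1 hx
    exact hL y hy
  · clear hL
    induction L with
    | nil => simp
    | cons a L ih =>
      simp only [List.map_cons, List.prod_cons]
      rw [← ih]
      group

lemma PC.inv {G : Type*} [Group G] {r : G} {n : ℕ} {g : G} (h : PC r n g) : PC r n g⁻¹ := by
  obtain ⟨L, rfl, hL, rfl⟩ := h
  induction L with
  | nil => simpa using PC.one r
  | cons a L ih =>
    have ih := ih (fun x hx => hL x (List.mem_cons_of_mem _ hx))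
    have h1 : PC r 1 (a.2 * a.1⁻¹ * a.2⁻¹) := by
      refine ⟨[(a.1⁻¹, a.2)], rfl, ?_, by simp⟩
      intro x hx
      have hx : x = (a.1⁻¹, a.2) := by simpa using hx
      subst hx
      simpa [or_comm] using hL a (by simp)
    have h2 := ih.mul h1
    simp only [List.map_cons, List.prod_cons, List.length_cons]
    convert h2 using 1
    group

lemma PC.npow {G : Type*} [Group G] (u v : G) (l : ℕ) : PC (u * v⁻¹) l (u ^ l * (v ^ l)⁻¹) := by
  induction l with
  | zero => simpa using PC.one _
  | succ l ih =>
    convert (ih.conj u).mul (PC.base (u * v⁻¹)) using 1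
    rw [pow_succ' u, pow_succ' v]
    group

lemma PC.zpow {G : Type*} [Group G] (u v : G) (l : ℤ) :
    PC (u * v⁻¹) l.natAbs (u ^ l * (v ^ l)⁻¹) := by
  rcases Int.eq_nat_or_neg l with ⟨n, rfl | rfl⟩
  · simpa using PC.npow u v n
  · have := ((PC.npow u v n).inv).conj (u ^ n)⁻¹
    convert this using 1
    · simp
    · simp only [zpow_neg, zpow_natCast]
      group

/-- exponent sum of `a_1` -/
def expo (m : ℕ) : FreeGroup (Fin (m + 2)) →* Multiplicative ℤ :=
  FreeGroup.lift fun i => if i = 0 then Multiplicative.ofAdd 1 else 1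

lemma expo_pow (m : ℕ) (k : ℤ) :
    (expo m ((FreeGroup.of 0 : FreeGroup (Fin (m + 2))) ^ k)).toAdd = k := by
  simp [expo]

lemma mk_cons {m : ℕ} (x : Fin (m + 2) × Bool) (W : Word m) :
    (FreeGroup.mk (x :: W)) = (cond x.2 (FreeGroup.of x.1) (FreeGroup.of x.1)⁻¹) *
      FreeGroup.mk W := by
  rcases x with ⟨i, b⟩
  cases b <;> simp [FreeGroup.of, FreeGroup.mul_mk, FreeGroup.inv_mk, FreeGroup.invRev]

lemma expo_le {m : ℕ} (Y : Word m) :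
    (expo m (FreeGroup.mk Y)).toAdd.natAbs ≤ countA1 Y := by
  induction Y with
  | nil => simp [← FreeGroup.one_eq_mk]
  | cons x Y ih =>
    rw [mk_cons, map_mul, toAdd_mul]
    refine (Int.natAbs_add_le _ _).trans ?_
    have hx : (expo m (cond x.2 (FreeGroup.of x.1) (FreeGroup.of x.1)⁻¹)).toAdd.natAbs ≤
        if x.1 = 0 then 1 else 0 := by
      rcases x with ⟨i, b⟩
      by_cases hi : i = 0 <;> cases b <;> simp [expo, hi]
    unfold countA1 at ih ⊢
    rw [List.countP_cons]
    simp only [decide_eq_true_eq]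
    omega

lemma pow_inj {m : ℕ} {n : ℤ} (hn : n ≠ 0) : Function.Injective
    (zpowersHom (FreeGroup (Fin (m + 2))) ((FreeGroup.of 0) ^ n)) := by
  intro a b h
  have := congrArg (fun g => (expo m g).toAdd) h
  simp only [zpowersHom_apply, ← zpow_mul, expo_pow] at this
  exact Multiplicative.toAdd.injective (mul_left_cancel₀ hn this)

/-- associated subgroups -/
abbrev AS (m : ℕ) (n : ℤ) : Subgroup (FreeGroup (Fin (m + 2))) :=
  (zpowersHom (FreeGroup (Fin (m + 2))) ((FreeGroup.of 0) ^ n)).range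

/-- the isomorphism of associated subgroups -/
noncomputable def isoS (m : ℕ) {n1 n2 : ℤ} (h1 : n1 ≠ 0) (h2 : n2 ≠ 0) : AS m n1 ≃* AS m n2 :=
  (MonoidHom.ofInjective (pow_inj h1)).symm.trans (MonoidHom.ofInjective (pow_inj h2))

lemma isoS_apply (m : ℕ) {n1 n2 : ℤ} (h1 : n1 ≠ 0) (h2 : n2 ≠ 0) :
    ((isoS m h1 h2 (MonoidHom.ofInjective (pow_inj h1) (Multiplicative.ofAdd 1)) :
      AS m n2) : FreeGroup (Fin (m + 2))) = FreeGroup.of 0 ^ n2 := by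
  simp only [isoS, MulEquiv.trans_apply, MulEquiv.symm_apply_apply]
  simp [MonoidHom.ofInjective_apply]

/-- the sign -/
def sgn (b : Bool) : ℤˣ := cond b 1 (-1)

/-- the map to the HNN extension -/
noncomputable def toHNN (m : ℕ) {n1 n2 : ℤ} (φ : AS m n1 ≃* AS m n2) :
    FreeGroup (Fin (m + 2)) →* HNNExtension (FreeGroup (Fin (m + 2))) (AS m n1) (AS m n2) φ :=
  FreeGroup.lift fun i => if i = 1 then HNNExtension.t else HNNExtension.of (FreeGroup.of i)

lemma toHNN_rel (m : ℕ) {n1 n2 : ℤ} (h1 : n1 ≠ 0) (h2 : n2 ≠ 0) :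
    toHNN m (isoS m h1 h2) (relBS m n1 n2) = 1 := by
  have h := HNNExtension.equiv_eq_conj (φ := isoS m h1 h2)
    (MonoidHom.ofInjective (pow_inj h1) (Multiplicative.ofAdd 1))
  rw [isoS_apply, MonoidHom.ofInjective_apply] at h
  simp only [zpowersHom_apply, toAdd_ofAdd, zpow_one, map_zpow] at h
  simp only [relBS, map_mul, map_zpow, map_inv, toHNN, FreeGroup.lift_apply_of]
  simp only [if_true, show ((0 : Fin (m + 2)) = 1) = False by simp, if_false]
  rw [← h, zpow_neg, mul_inv_cancel]

/-- a pinch -/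
def Pinch {m : ℕ} (n1 n2 : ℤ) (W : Word m) : Prop :=
  ∃ (X : Word m) (e : Bool) (Y Z : Word m) (l : ℤ), W = X ++ (1, e) :: (Y ++ (1, !e) :: Z) ∧
    FreeGroup.mk Y = FreeGroup.of 0 ^ ((cond e n1 n2) * l)

lemma britton_aux {m : ℕ} {n1 n2 : ℤ} (φ : AS m n1 ≃* AS m n2) (W : Word m) :
    Pinch n1 n2 W ∨ ∃ w : HNNExtension.NormalWord.ReducedWord
        (FreeGroup (Fin (m + 2))) (AS m n1) (AS m n2),
      w.prod φ = toHNN m φ (FreeGroup.mk W) ∧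
      ∃ Y : Word m, w.head = FreeGroup.mk Y ∧ ((W = Y ∧ w.toList = []) ∨
        ∃ e Z g l, W = Y ++ (1, e) :: Z ∧ w.toList = (sgn e, g) :: l) := by
  induction W with
  | nil =>
    right
    refine ⟨HNNExtension.NormalWord.ReducedWord.empty _ _ _, ?_, [], ?_, Or.inl ⟨rfl, rfl⟩⟩
    · simp [HNNExtension.NormalWord.ReducedWord.prod, ← FreeGroup.one_eq_mk]
    · simp [← FreeGroup.one_eq_mk]
  | cons x W ih =>
    rcases ih with ⟨X, e, Y, Z, l, rfl, h⟩ | ⟨w, hw, Y, hY, hc⟩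
    · exact Or.inl ⟨x :: X, e, Y, Z, l, rfl, h⟩
    · rcases x with ⟨i, b⟩
      by_cases hi : i = 1
      · subst hi
        by_cases hp : ∃ Z, W = Y ++ (1, !b) :: Z ∧
          w.head ∈ HNNExtension.toSubgroup (AS m n1) (AS m n2) (sgn b)
        · left
          obtain ⟨Z, rfl, hmem⟩ := hp
          rw [hY] at hmem
          have : ∃ l : ℤ, FreeGroup.mk Y = FreeGroup.of 0 ^ ((cond b n1 n2) * l) := by
            cases b
            · obtain ⟨l, hl⟩ := hmem
              exact ⟨l.toAdd, by rw [← hl]; simp [zpow_mul]⟩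
            · obtain ⟨l, hl⟩ := hmem
              exact ⟨l.toAdd, by rw [← hl]; simp [zpow_mul]⟩
          obtain ⟨l, hl⟩ := this
          exact ⟨[], b, Y, Z, l, rfl, hl⟩
        · right
          refine ⟨⟨1, (sgn b, w.head) :: w.toList, ?_⟩, ?_, [], ?_, Or.inr
            ⟨b, W, w.head, w.toList, rfl, rfl⟩⟩
          · rw [List.isChain_cons]
            refine ⟨?_, w.chain⟩
            intro y hy hmem
            rcases hc with ⟨_, hnil⟩ | ⟨e, Z, g, l, rfl, hl⟩
            · simp [hnil] at hy
            · simp only [hl, List.head?_cons, Option.mem_def, Option.some.injEq] at hy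
              subst hy
              by_contra hne
              apply hp
              refine ⟨Z, ?_, hmem⟩
              have : e = !b := by
                cases e <;> cases b <;> simp_all
              rw [this]
          · rw [mk_cons, map_mul, ← hw]
            simp only [HNNExtension.NormalWord.ReducedWord.prod, List.map_cons, List.prod_cons]
            cases b <;> simp [toHNN, sgn, mul_assoc]
          · simp [← FreeGroup.one_eq_mk]
      · right
        refine ⟨⟨(cond b (FreeGroup.of i) (FreeGroup.of i)⁻¹) * w.head, w.toList, w.chain⟩, ?_,
          (i, b) :: Y, ?_, ?_⟩
        · rw [mk_cons, map_mul, ← hw]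
          simp only [HNNExtension.NormalWord.ReducedWord.prod]
          cases b <;> simp [toHNN, hi, mul_assoc]
        · rw [mk_cons, hY]
        · rcases hc with ⟨rfl, h⟩ | ⟨e, Z, g, l, rfl, hl⟩
          · exact Or.inl ⟨rfl, h⟩
          · exact Or.inr ⟨e, Z, g, l, rfl, hl⟩

lemma britton {m : ℕ} {n1 n2 : ℤ} (h1 : n1 ≠ 0) (h2 : n2 ≠ 0) (W : Word m)
    (hW : FreeGroup.mk W ∈ Subgroup.normalClosure {relBS m n1 n2}) :
    Pinch n1 n2 W ∨ FreeGroup.mk W = 1 := by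
  have hker : toHNN m (isoS m h1 h2) (FreeGroup.mk W) = 1 := by
    have : Subgroup.normalClosure {relBS m n1 n2} ≤ (toHNN m (isoS m h1 h2)).ker := by
      apply Subgroup.normalClosure_le_normal
      simpa using toHNN_rel m h1 h2
    exact this hW
  rcases britton_aux (isoS m h1 h2) W with h | ⟨w, hw, Y, hY, hc⟩
  · exact Or.inl h
  · right
    rw [hker] at hw
    have hnil := HNNExtension.ReducedWord.toList_eq_nil_of_mem_of_range (isoS m h1 h2) w
      (by rw [hw]; exact one_mem _)
    rcases hc with ⟨rfl, _⟩ | ⟨e, Z, g, l, rfl, hl⟩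
    · rw [← hY]
      apply HNNExtension.of_injective (φ := isoS m h1 h2)
      simpa [HNNExtension.NormalWord.ReducedWord.prod, hnil] using hw
    · simp [hnil] at hl

lemma exists_word (m : ℕ) (k : ℤ) : ∃ V : Word m, FreeGroup.mk V = FreeGroup.of 0 ^ k ∧
    countA1 V = k.natAbs ∧ noA1 V = 0 := by
  have key : ∀ (b : Bool) (n : ℕ), FreeGroup.mk (List.replicate n ((0 : Fin (m + 2)), b)) =
      (cond b (FreeGroup.of 0) (FreeGroup.of 0)⁻¹) ^ n := by
    intro b n
    induction n with
    | zero => simp [← FreeGroup.one_eq_mk]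
    | succ n ih => rw [List.replicate_succ, mk_cons, ih, pow_succ']
  rcases Int.eq_nat_or_neg k with ⟨n, rfl | rfl⟩
  · exact ⟨List.replicate n (0, true), by rw [key]; simp, by simp [countA1, List.countP_replicate], by simp [noA1]⟩
  · exact ⟨List.replicate n (0, false), by rw [key]; simp, by simp [countA1, List.countP_replicate], by simp [noA1]⟩

lemma pinch_cost (m : ℕ) (n1 n2 : ℤ) (e : Bool) (l : ℤ) :
    PC (relBS m n1 n2) l.natAbs
      ((cond e (FreeGroup.of 1) (FreeGroup.of 1)⁻¹) * FreeGroup.of 0 ^ ((cond e n1 n2) * l) *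
        (cond e (FreeGroup.of 1) (FreeGroup.of 1)⁻¹)⁻¹ *
        (FreeGroup.of 0 ^ ((cond e n2 n1) * l))⁻¹) := by
  have h := PC.zpow (FreeGroup.of (1 : Fin (m + 2)) * FreeGroup.of 0 ^ n1 * (FreeGroup.of 1)⁻¹)
    (FreeGroup.of 0 ^ n2) l
  have hr : FreeGroup.of (1 : Fin (m + 2)) * FreeGroup.of 0 ^ n1 * (FreeGroup.of 1)⁻¹ *
    (FreeGroup.of 0 ^ n2)⁻¹ = relBS m n1 n2 := by simp [relBS]
  rw [hr, conj_zpow, ← zpow_mul, ← zpow_mul] at h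
  cases e
  · convert h.inv.conj (FreeGroup.of 1)⁻¹ using 1
    simp only [cond_false]
    group
  · exact h

lemma main_bound (m : ℕ) (n1 n2 : ℤ) (n0 : ℕ) (hn0 : 0 < n0)
    (h1 : n1.natAbs = n0) (h2 : n2.natAbs = n0) (q : ℕ) : ∀ (W : Word m), noA1 W ≤ q →
    FreeGroup.mk W ∈ Subgroup.normalClosure {relBS m n1 n2} →
    ∃ k : ℕ, PC (relBS m n1 n2) k (FreeGroup.mk W) ∧ n0 * k ≤ countA1 W * noA1 W := by
  induction q using Nat.strong_induction_on with
  | _ q ih =>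
  intro W hq hW
  rcases britton (by omega) (by omega) W hW with ⟨X, e, Y, Z, l, rfl, hY⟩ | h
  · obtain ⟨V, hV, hV1, hV2⟩ := exists_word m ((cond e n2 n1) * l)
    have hcost := (pinch_cost m n1 n2 e l).conj (FreeGroup.mk X)
    have hfac : FreeGroup.mk (X ++ (1, e) :: (Y ++ (1, !e) :: Z)) =
        (FreeGroup.mk X * ((cond e (FreeGroup.of 1) (FreeGroup.of 1)⁻¹) *
          FreeGroup.of 0 ^ ((cond e n1 n2) * l) *
        (cond e (FreeGroup.of 1) (FreeGroup.of 1)⁻¹)⁻¹ *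
        (FreeGroup.of 0 ^ ((cond e n2 n1) * l))⁻¹) * (FreeGroup.mk X)⁻¹) *
        FreeGroup.mk (X ++ (V ++ Z)) := by
      rw [← FreeGroup.mul_mk, mk_cons, ← FreeGroup.mul_mk, mk_cons, ← FreeGroup.mul_mk,
        ← FreeGroup.mul_mk, hY, hV]
      cases e <;> simp [mul_assoc, -FreeGroup.inv_mk]
    have hpc : ∀ {k g}, PC (relBS m n1 n2) k g →
        g ∈ Subgroup.normalClosure {relBS m n1 n2} := by
      rintro k g ⟨L, -, hL, rfl⟩
      apply Subgroup.list_prod_mem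
      intro x hx
      obtain ⟨y, hy, rfl⟩ := List.mem_map.1 hx
      apply Subgroup.normalClosure_normal.conj_mem
      rcases hL y hy with h | h
      · rw [h]; exact Subgroup.subset_normalClosure rfl
      · rw [← inv_mem_iff, h]; exact Subgroup.subset_normalClosure rfl
    have hle : n0 * l.natAbs ≤ countA1 Y := by
      have := expo_le Y
      rw [hY, expo_pow, Int.natAbs_mul] at this
      cases e <;> simp_all
    have hVY : countA1 V ≤ countA1 Y := by
      rw [hV1, Int.natAbs_mul]
      cases e <;> simp_all
    have ca : ∀ U U' : Word m, countA1 (U ++ U') = countA1 U + countA1 U' := by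
      simp [countA1]
    have cb : ∀ U U' : Word m, noA1 (U ++ U') = noA1 U + noA1 U' := by
      simp [noA1]
    have cc : ∀ (b : Bool) (U : Word m), countA1 ((1, b) :: U) = countA1 U := by
      simp [countA1]
    have cd : ∀ (b : Bool) (U : Word m), noA1 ((1, b) :: U) = noA1 U + 1 := by
      simp [noA1]
    rw [hfac, Subgroup.mul_mem_cancel_left _ (hpc hcost)] at hW
    simp only [ca, cb, cc, cd] at hq ⊢
    obtain ⟨k, hk, hkle⟩ := ih (q - 1) (by omega) (X ++ (V ++ Z))
      (by simp only [cb]; omega) hW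
    refine ⟨l.natAbs + k, ?_, ?_⟩
    · rw [hfac]; exact hcost.mul hk
    · simp only [ca, cb, hV2] at hkle
      nlinarith [Nat.zero_le (countA1 X), Nat.zero_le (countA1 Z), Nat.mul_le_mul_right
        (noA1 X + noA1 Z) hVY, Nat.zero_le ((countA1 X + countA1 Y + countA1 Z) * noA1 Y)]
  · exact ⟨0, by rw [h]; exact PC.one _, by simp⟩

/-- Group-theoretic content of Lemma 9.1 (quadratic isoperimetric bound): if
`|n_1| = |n_2| = n_0 > 0` and `W = 1` in `G_3`, then `W` is a product of at most
`|W|²/(4n_0)` conjugates of `r^{±1}` in `F(A)`. -/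
theorem statement14 (m : ℕ) (n1 n2 : ℤ) (n0 : ℕ) (hn0 : 0 < n0)
    (h1 : |n1| = (n0 : ℤ)) (h2 : |n2| = (n0 : ℤ))
    (W : Word m)
    (hW : evalW W ∈ Subgroup.normalClosure {relBS m n1 n2}) :
    ∃ k : ℕ, IsProdConj {relBS m n1 n2} k (evalW W) ∧ 4 * n0 * k ≤ W.length ^ 2 := by
  obtain ⟨k, hk, hle⟩ := main_bound m n1 n2 n0 hn0 (by rw [Int.abs_eq_natAbs] at h1; exact_mod_cast h1)
    (by rw [Int.abs_eq_natAbs] at h2; exact_mod_cast h2) _ W le_rfl hW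
  refine ⟨k, hk.isProdConj, ?_⟩
  have hlen : W.length = countA1 W + noA1 W := by
    unfold countA1 noA1
    rw [List.length_eq_countP_add_countP (fun x => decide (x.1 = (0 : Fin (m + 2))))]
    simp
  rw [hlen]
  zify at hle ⊢
  nlinarith [sq_nonneg ((countA1 W : ℤ) - noA1 W)]

end Stmt14
end

section
/- Let G_2 be given by presentation (1.2) and let U be a word over A^{±1} such that U = 1 in G_2 and U has property (E). Then there is a factorization U ≡ U_1U_2 into subwords with |U_1| > 0 and |U_2| > 0 such that U_1 = 1 in G_2, U_2 = 1 in G_2, and μ_2(U) = μ_2(U_1) + μ_2(U_2). [Lemma 5.2] -/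
namespace Stmt16

/-- Words over the alphabet `A^{±1}` where `A = {a_1, ..., a_m}`. -/
abbrev Word (m : ℕ) := List (Fin m × Bool)

/-- The image of a word in the free group `F(A)`. -/
def evalW {m : ℕ} (w : Word m) : FreeGroup (Fin m) := FreeGroup.mk w

/-- The relator set `R_2 = {a_i^k : k ∈ E_i, k ≠ 0}` of presentation (1.2). -/
def Rel2 (m : ℕ) (E : Fin m → Set ℕ) : Set (FreeGroup (Fin m)) :=
  {g | ∃ (i : Fin m) (k : ℕ), k ∈ E i ∧ k ≠ 0 ∧ g = FreeGroup.of i ^ k}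

/-- `g` is a product of exactly `n` conjugates of elements of `R ∪ R⁻¹`. -/
def IsProdConj {G : Type*} [Group G] (R : Set G) (n : ℕ) (g : G) : Prop :=
  ∃ r s : Fin n → G,
    (∀ i, r i ∈ R ∨ (r i)⁻¹ ∈ R) ∧
    g = (List.ofFn fun i => s i * r i * (s i)⁻¹).prod

/-- `μ_2(U)`: the minimal number `n` such that `U` is a product of `n` conjugates of
words in `R_2^{±1}` in `F(A)`. -/
noncomputable def mu2 (m : ℕ) (E : Fin m → Set ℕ) (g : FreeGroup (Fin m)) : ℕ :=
  sInf {k | IsProdConj (Rel2 m E) k g}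


section PC
variable {G : Type*} [Group G] {R : Set G}

theorem isProdConj_iff (n : ℕ) (g : G) : IsProdConj R n g ↔
    ∃ l : List G, l.length = n ∧ (∀ x ∈ l, ∃ r s : G, (r ∈ R ∨ r⁻¹ ∈ R) ∧ x = s * r * s⁻¹) ∧
      g = l.prod := by
  constructor
  · rintro ⟨r, s, h, rfl⟩
    refine ⟨_, by simp, ?_, rfl⟩
    intro x hx
    rw [List.mem_ofFn] at hx
    obtain ⟨i, rfl⟩ := hx
    exact ⟨r i, s i, h i, rfl⟩
  · rintro ⟨l, rfl, h, rfl⟩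
    have h' : ∀ i : Fin l.length, ∃ r s : G, (r ∈ R ∨ r⁻¹ ∈ R) ∧ l.get i = s * r * s⁻¹ :=
      fun i => h _ (List.get_mem l i)
    choose r s h1 h2 using h'
    refine ⟨r, s, h1, ?_⟩
    simp_rw [← h2]
    rw [List.ofFn_get]

theorem pc_one : IsProdConj R 0 (1 : G) := by
  rw [isProdConj_iff]; exact ⟨[], by simp⟩

theorem pc_mul {a b : ℕ} {g h : G} (hg : IsProdConj R a g) (hh : IsProdConj R b h) :
    IsProdConj R (a + b) (g * h) := by
  rw [isProdConj_iff] at *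
  obtain ⟨l, h1, h2, h3⟩ := hg
  obtain ⟨l', h1', h2', h3'⟩ := hh
  refine ⟨l ++ l', by simp [h1, h1'], ?_, by simp [h3, h3']⟩
  intro x hx
  rcases List.mem_append.1 hx with hx | hx
  · exact h2 x hx
  · exact h2' x hx

theorem pc_conj {a : ℕ} {g : G} (t : G) (hg : IsProdConj R a g) :
    IsProdConj R a (t * g * t⁻¹) := by
  rw [isProdConj_iff] at *
  obtain ⟨l, h1, h2, h3⟩ := hg
  refine ⟨l.map (MulAut.conj t), by simp [h1], ?_, ?_⟩
  · intro x hx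
    obtain ⟨y, hy, rfl⟩ := List.mem_map.1 hx
    obtain ⟨r, s, h, rfl⟩ := h2 y hy
    exact ⟨r, t * s, h, by simp [mul_assoc]⟩
  · rw [← MulAut.conj_apply, h3, map_list_prod]

theorem pc_single {r : G} (h : r ∈ R ∨ r⁻¹ ∈ R) : IsProdConj R 1 r := by
  rw [isProdConj_iff]; exact ⟨[r], by simp, by simpa using ⟨r, h, 1, by simp⟩, by simp⟩

theorem pc_mem {n : ℕ} {g : G} (h : IsProdConj R n g) : g ∈ Subgroup.normalClosure R := by
  rw [isProdConj_iff] at h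
  obtain ⟨l, -, h2, rfl⟩ := h
  refine Subgroup.list_prod_mem _ ?_
  intro x hx
  obtain ⟨r, s, h, rfl⟩ := h2 x hx
  refine Subgroup.normalClosure_normal.conj_mem _ ?_ _
  rcases h with h | h
  · exact Subgroup.subset_normalClosure h
  · exact (Subgroup.inv_mem_iff _).1 (Subgroup.subset_normalClosure h)

theorem pc_inv {n : ℕ} {g : G} (h : IsProdConj R n g) : IsProdConj R n g⁻¹ := by
  rw [isProdConj_iff] at *
  obtain ⟨l, h1, h2, h3⟩ := h
  refine ⟨(l.map (·⁻¹)).reverse, by simp [h1], ?_, by rw [h3, List.prod_inv_reverse]⟩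
  intro x hx
  rw [List.mem_reverse] at hx
  obtain ⟨y, hy, rfl⟩ := List.mem_map.1 hx
  obtain ⟨r, s, h, rfl⟩ := h2 y hy
  exact ⟨r⁻¹, s, by simpa using h.symm, by group⟩

theorem pc_exists {g : G} (h : g ∈ Subgroup.normalClosure R) : ∃ n, IsProdConj R n g := by
  unfold Subgroup.normalClosure at h
  induction h using Subgroup.closure_induction with
  | mem x hx =>
    obtain ⟨r, hr, hc⟩ := Group.mem_conjugatesOfSet_iff.1 hx
    obtain ⟨c, rfl⟩ := isConj_iff.1 hc
    exact ⟨1, pc_conj _ (pc_single (Or.inl hr))⟩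
  | one => exact ⟨0, pc_one⟩
  | mul x y _ _ hx hy =>
    obtain ⟨a, ha⟩ := hx
    obtain ⟨b, hb⟩ := hy
    exact ⟨_, pc_mul ha hb⟩
  | inv x _ hx =>
    obtain ⟨a, ha⟩ := hx
    exact ⟨a, pc_inv ha⟩

end PC

variable {m : ℕ} {E : Fin m → Set ℕ}

/-- Syllable words `(i, e)` reducible to the empty word by merging adjacent syllables and deleting
a syllable `a_i^e` at the cost of the number of relators producing it. -/
inductive Red (E : Fin m → Set ℕ) : List (Fin m × ℤ) → ℕ → Prop
  | nil (n : ℕ) : Red E [] n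
  | merge (P Q : List (Fin m × ℤ)) (i : Fin m) (e f : ℤ) (n : ℕ) :
      Red E (P ++ (i, e + f) :: Q) n → Red E (P ++ (i, e) :: (i, f) :: Q) n
  | del (P Q : List (Fin m × ℤ)) (i : Fin m) (e : ℤ) (k n : ℕ) :
      IsProdConj (Rel2 m E) k (FreeGroup.of i ^ e) →
      Red E (P ++ Q) n → Red E (P ++ (i, e) :: Q) (k + n)

theorem Red.merge' {W W' : List (Fin m × ℤ)} (P Q : List (Fin m × ℤ)) (i : Fin m) (e f : ℤ) {n : ℕ}
    (h : Red E W' n) (h1 : W' = P ++ (i, e + f) :: Q) (h2 : W = P ++ (i, e) :: (i, f) :: Q) :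
    Red E W n := by
  subst h1 h2; exact Red.merge _ _ _ _ _ _ h

theorem Red.del' {W W' : List (Fin m × ℤ)} (P Q : List (Fin m × ℤ)) (i : Fin m) (e : ℤ) {k n N : ℕ}
    (hk : IsProdConj (Rel2 m E) k (FreeGroup.of i ^ e))
    (h : Red E W' n) (h1 : W' = P ++ Q) (h2 : W = P ++ (i, e) :: Q) (hN : N = k + n) :
    Red E W N := by
  subst h1 h2 hN; exact Red.del _ _ _ _ _ _ hk h

theorem Red.mono {W : List (Fin m × ℤ)} {n : ℕ} (h : Red E W n) : ∀ n', n ≤ n' → Red E W n' := by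
  induction h with
  | nil n => intro n' _; exact Red.nil _
  | merge P Q i e f n _ ih => intro n' h; exact Red.merge _ _ _ _ _ _ (ih _ h)
  | del P Q i e k n hk _ ih =>
    intro n' h
    exact Red.del' P Q i e hk (ih (n' - k) (by omega)) rfl rfl (by omega)

/-- absorbing a cheap power -/
theorem Red.absorb {W : List (Fin m × ℤ)} {n : ℕ} (h : Red E W n) :
    ∀ (P Q : List (Fin m × ℤ)) (i : Fin m) (e f : ℤ) (k : ℕ), W = P ++ (i, f) :: Q →
    IsProdConj (Rel2 m E) k (FreeGroup.of i ^ e) → Red E (P ++ (i, e + f) :: Q) (k + n) := by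
  induction h with
  | nil n => intro P Q i e f k h; simp at h
  | merge P' Q' j a b n _ ih =>
    intro P Q i e f k h hk
    rcases List.append_eq_append_iff.1 h with ⟨t, h1, h2⟩ | ⟨t, h1, h2⟩
    · rcases t with _ | ⟨x, _ | ⟨y, t⟩⟩
      · simp at h1 h2
        obtain ⟨⟨rfl, rfl⟩, rfl⟩ := h2
        subst h1
        exact Red.merge' P Q' j (e + a) b (ih P Q' j e (a + b) k rfl hk) (by simp [add_assoc]) rfl
      · simp at h1 h2
        obtain ⟨rfl, ⟨rfl, rfl⟩, rfl⟩ := h2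
        subst h1
        exact Red.merge' P' Q' j a (e + b) (ih P' Q' j e (a + b) k rfl hk)
          (by simp; ring) (by simp)
      · simp at h1 h2
        obtain ⟨rfl, rfl, rfl⟩ := h2
        subst h1
        exact Red.merge' P' (t ++ (i, e + f) :: Q) j a b
          (ih (P' ++ (j, a + b) :: t) Q i e f k (by simp) hk) (by simp) (by simp)
    · rcases t with _ | ⟨x, t⟩
      · simp at h1 h2
        obtain ⟨⟨rfl, rfl⟩, rfl⟩ := h2
        subst h1
        exact Red.merge' P' Q' i (e + f) b (ih P' Q' i e (f + b) k rfl hk) (by simp [add_assoc]) rfl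
      · simp at h1 h2
        obtain ⟨rfl, rfl⟩ := h2
        subst h1
        exact Red.merge' (P ++ (i, e + f) :: t) Q' j a b
          (ih P (t ++ (j, a + b) :: Q') i e f k (by simp) hk) (by simp) (by simp)
  | del P' Q' j a c n hc hr ih =>
    intro P Q i e f k h hk
    rcases List.append_eq_append_iff.1 h with ⟨t, h1, h2⟩ | ⟨t, h1, h2⟩
    · rcases t with _ | ⟨x, t⟩
      · simp at h1 h2
        obtain ⟨⟨rfl, rfl⟩, rfl⟩ := h2
        subst h1
        refine Red.del' P Q' j (e + a) (k := k + c) ?_ hr rfl rfl (by omega)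
        rw [zpow_add]; exact pc_mul hk hc
      · simp at h1 h2
        obtain ⟨rfl, rfl⟩ := h2
        subst h1
        exact Red.del' P' (t ++ (i, e + f) :: Q) j a hc
          (ih (P' ++ t) Q i e f k (by simp) hk) (by simp) (by simp) (by omega)
    · rcases t with _ | ⟨x, t⟩
      · simp at h1 h2
        obtain ⟨⟨rfl, rfl⟩, rfl⟩ := h2
        subst h1
        refine Red.del' P' _ i (e + f) (k := k + c) ?_ hr rfl rfl (by omega)
        rw [zpow_add]; exact pc_mul hk hc
      · simp at h1 h2
        obtain ⟨rfl, rfl⟩ := h2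
        subst h1
        exact Red.del' (P ++ (i, e + f) :: t) Q' j a hc
          (ih P (t ++ Q') i e f k (by simp) hk) (by simp) (by simp) (by omega)

/-- merging is invertible -/
theorem Red.join {W : List (Fin m × ℤ)} {n : ℕ} (h : Red E W n) :
    ∀ (P Q : List (Fin m × ℤ)) (i : Fin m) (e f : ℤ), W = P ++ (i, e) :: (i, f) :: Q →
    Red E (P ++ (i, e + f) :: Q) n := by
  induction h with
  | nil n => intro P Q i e f h; simp at h
  | merge P' Q' j a b n hr ih =>
    intro P Q i e f h
    rcases List.append_eq_append_iff.1 h with ⟨t, h1, h2⟩ | ⟨t, h1, h2⟩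
    · rcases t with _ | ⟨x, _ | ⟨y, t⟩⟩
      · simp at h1 h2
        obtain ⟨⟨rfl, rfl⟩, ⟨_, rfl⟩, rfl⟩ := h2
        subst h1
        exact hr
      · simp at h1 h2
        obtain ⟨rfl, ⟨rfl, rfl⟩, rfl⟩ := h2
        subst h1
        exact Red.merge' P' Q j a (b + f) (ih P' Q j (a + b) f rfl) (by simp [add_assoc]) (by simp)
      · simp at h1 h2
        obtain ⟨rfl, rfl, rfl⟩ := h2
        subst h1
        exact Red.merge' P' (t ++ (i, e + f) :: Q) j a b
          (ih (P' ++ (j, a + b) :: t) Q i e f (by simp)) (by simp) (by simp)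
    · rcases t with _ | ⟨x, _ | ⟨y, t⟩⟩
      · simp at h1 h2
        obtain ⟨⟨rfl, rfl⟩, ⟨_, rfl⟩, rfl⟩ := h2
        subst h1
        exact hr
      · simp at h1 h2
        obtain ⟨rfl, ⟨rfl, rfl⟩, rfl⟩ := h2
        subst h1
        exact Red.merge' P Q' i (e + f) b (ih P Q' i e (f + b) (by simp))
          (by simp [add_assoc]) (by simp)
      · simp at h1 h2
        obtain ⟨rfl, rfl, rfl⟩ := h2
        subst h1
        exact Red.merge' (P ++ (i, e + f) :: t) Q' j a b
          (ih P (t ++ (j, a + b) :: Q') i e f (by simp)) (by simp) (by simp)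
  | del P' Q' j a c n hc hr ih =>
    intro P Q i e f h
    rcases List.append_eq_append_iff.1 h with ⟨t, h1, h2⟩ | ⟨t, h1, h2⟩
    · rcases t with _ | ⟨x, t⟩
      · simp at h1 h2
        obtain ⟨⟨rfl, rfl⟩, rfl⟩ := h2
        subst h1
        exact hr.absorb P Q j a f c (by simp) hc
      · simp at h1 h2
        obtain ⟨rfl, rfl⟩ := h2
        subst h1
        exact Red.del' P' (t ++ (i, e + f) :: Q) j a hc
          (ih (P' ++ t) Q i e f (by simp)) (by simp) (by simp) (by omega)
    · rcases t with _ | ⟨x, _ | ⟨y, t⟩⟩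
      · simp at h1 h2
        obtain ⟨⟨rfl, rfl⟩, rfl⟩ := h2
        subst h1
        exact hr.absorb P' Q i e f c (by simp) hc
      · simp at h1 h2
        obtain ⟨rfl, ⟨rfl, rfl⟩, rfl⟩ := h2
        subst h1
        rw [add_comm e]
        exact hr.absorb P _ _ _ e c (by simp) hc
      · simp at h1 h2
        obtain ⟨rfl, rfl, rfl⟩ := h2
        subst h1
        exact Red.del' (P ++ (i, e + f) :: t) Q' j a hc
          (ih P (t ++ Q') i e f (by simp)) (by simp) (by simp) (by omega)

theorem Red.zero {W : List (Fin m × ℤ)} {n : ℕ} (h : Red E W n) :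
    ∀ (P Q : List (Fin m × ℤ)) (i : Fin m), W = P ++ (i, 0) :: Q → Red E (P ++ Q) n := by
  induction h with
  | nil n => intro P Q i h; simp at h
  | merge P' Q' j a b n hr ih =>
    intro P Q i h
    rcases List.append_eq_append_iff.1 h with ⟨t, h1, h2⟩ | ⟨t, h1, h2⟩
    · rcases t with _ | ⟨x, _ | ⟨y, t⟩⟩
      · simp at h1 h2
        obtain ⟨⟨rfl, rfl⟩, rfl⟩ := h2
        subst h1
        simpa using hr
      · simp at h1 h2
        obtain ⟨rfl, ⟨rfl, rfl⟩, rfl⟩ := h2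
        subst h1
        simpa using hr
      · simp at h1 h2
        obtain ⟨rfl, rfl, rfl⟩ := h2
        subst h1
        exact Red.merge' P' (t ++ Q) j a b
          (ih (P' ++ (j, a + b) :: t) Q i (by simp)) (by simp) (by simp)
    · rcases t with _ | ⟨x, t⟩
      · simp at h1 h2
        obtain ⟨⟨rfl, rfl⟩, rfl⟩ := h2
        subst h1
        simpa using hr
      · simp at h1 h2
        obtain ⟨rfl, rfl⟩ := h2
        subst h1
        exact Red.merge' (P ++ t) Q' j a b
          (ih P (t ++ (j, a + b) :: Q') i (by simp)) (by simp) (by simp)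
  | del P' Q' j a c n hc hr ih =>
    intro P Q i h
    rcases List.append_eq_append_iff.1 h with ⟨t, h1, h2⟩ | ⟨t, h1, h2⟩
    · rcases t with _ | ⟨x, t⟩
      · simp at h1 h2
        obtain ⟨⟨rfl, rfl⟩, rfl⟩ := h2
        subst h1
        exact hr.mono _ (by omega)
      · simp at h1 h2
        obtain ⟨rfl, rfl⟩ := h2
        subst h1
        exact Red.del' P' (t ++ Q) j a hc
          (ih (P' ++ t) Q i (by simp)) (by simp) (by simp) (by omega)
    · rcases t with _ | ⟨x, t⟩
      · simp at h1 h2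
        obtain ⟨⟨rfl, rfl⟩, rfl⟩ := h2
        subst h1
        exact hr.mono _ (by omega)
      · simp at h1 h2
        obtain ⟨rfl, rfl⟩ := h2
        subst h1
        exact Red.del' (P ++ t) Q' j a hc
          (ih P (t ++ Q') i (by simp)) (by simp) (by simp) (by omega)

theorem Red.insert {W : List (Fin m × ℤ)} {n : ℕ} (h : Red E W n) (P Q : List (Fin m × ℤ))
    {n' : ℕ} (h' : Red E (P ++ Q) n') : Red E (P ++ W ++ Q) (n + n') := by
  induction h with
  | nil n => simpa using h'.mono _ (by omega)
  | merge P' Q' j a b n hr ih =>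
    exact Red.merge' (P ++ P') (Q' ++ Q) j a b ih (by simp) (by simp)
  | del P' Q' j a c n hc hr ih =>
    exact Red.del' (P ++ P') (Q' ++ Q) j a hc ih (by simp) (by simp) (by omega)

/-- The splitting lemma. -/
theorem Red.split {W : List (Fin m × ℤ)} {n : ℕ} (h : Red E W n) :
    ∀ x y, W.head? = some x → W.getLast? = some y → x.1 ≠ y.1 →
    ∃ W1 W2 n1 n2, W = W1 ++ W2 ∧ W1 ≠ [] ∧ W2 ≠ [] ∧ n = n1 + n2 ∧ Red E W1 n1 ∧ Red E W2 n2 := by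
  induction h with
  | nil n => intro x y h; simp at h
  | merge P Q j a b n hr ih =>
    intro x y hx hy hxy
    obtain ⟨x', hx', hx1⟩ : ∃ x', (P ++ (j, a + b) :: Q).head? = some x' ∧ x'.1 = x.1 := by
      rcases P with _ | ⟨p, P⟩
      · simp at hx ⊢; rw [← hx]
      · simp at hx ⊢; rw [← hx]
    obtain ⟨y', hy', hy1⟩ : ∃ y', (P ++ (j, a + b) :: Q).getLast? = some y' ∧ y'.1 = y.1 := by
      rcases List.eq_nil_or_concat Q with rfl | ⟨Q, q, rfl⟩
      · simp at hy ⊢; rw [← hy]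
      · simp [List.getLast?_cons] at hy ⊢; rw [← hy]
    obtain ⟨W1, W2, n1, n2, hW, h1, h2, hn, hr1, hr2⟩ := ih x' y' hx' hy' (by rwa [hx1, hy1])
    rcases List.append_eq_append_iff.1 hW with ⟨t, ht, ht2⟩ | ⟨t, ht, ht2⟩
    · rcases t with _ | ⟨z, t⟩
      · simp at ht ht2
        subst ht ht2
        exact ⟨W1, (j, a) :: (j, b) :: Q, n1, n2, by simp, h1, by simp, hn, hr1,
          Red.merge' [] Q j a b hr2 (by simp) (by simp)⟩
      · simp at ht2
        obtain ⟨rfl, rfl⟩ := ht2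
        exact ⟨P ++ (j, a) :: (j, b) :: t, W2, n1, n2, by simp, by simp, h2, hn,
          Red.merge' P t j a b hr1 ht rfl, hr2⟩
    · subst ht ht2
      exact ⟨W1, t ++ (j, a) :: (j, b) :: Q, n1, n2, by simp, h1, by simp, hn, hr1,
        Red.merge' t Q j a b hr2 rfl rfl⟩
  | del P Q j a c n hc hr ih =>
    intro x y hx hy hxy
    have hs : Red E [(j, a)] c := Red.del' [] [] j a hc (Red.nil 0) (by simp) (by simp) (by simp)
    rcases P with _ | ⟨p, P⟩
    · rcases Q with _ | ⟨q, Q⟩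
      · simp at hx hy; subst hx hy; simp at hxy
      · exact ⟨[(j, a)], q :: Q, c, n, by simp, by simp, by simp, rfl, hs, by simpa using hr⟩
    · rcases List.eq_nil_or_concat Q with rfl | ⟨Q, q, rfl⟩
      · exact ⟨p :: P, [(j, a)], n, c, by simp, by simp, by simp, by omega, by simpa using hr, hs⟩
      · simp only [List.concat_eq_append] at *
        obtain ⟨W1, W2, n1, n2, hW, h1, h2, hn, hr1, hr2⟩ := ih x y (by simpa using hx)
          (by simpa [List.getLast?_append, List.getLast?_cons] using hy) hxy
        rcases List.append_eq_append_iff.1 hW with ⟨t, ht, ht2⟩ | ⟨t, ht, ht2⟩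
        · refine ⟨p :: P ++ (j, a) :: t, W2, c + n1, n2, by simp [ht2], by simp, h2, by omega,
            Red.del' (p :: P) t j a hc hr1 ht rfl rfl, hr2⟩
        · refine ⟨W1, t ++ (j, a) :: (Q ++ [q]), n1, c + n2, by simp [ht], h1, by simp, by omega,
            hr1, Red.del' t (Q ++ [q]) j a hc hr2 ht2 rfl rfl⟩

/-- Value of a syllable word. -/
def sylVal (W : List (Fin m × ℤ)) : FreeGroup (Fin m) :=
  (W.map fun x => FreeGroup.of x.1 ^ x.2).prod

theorem Red.sound {W : List (Fin m × ℤ)} {n : ℕ} (h : Red E W n) :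
    ∃ n' ≤ n, IsProdConj (Rel2 m E) n' (sylVal W) := by
  induction h with
  | nil n => exact ⟨0, by simp, pc_one⟩
  | merge P Q j a b n hr ih =>
    obtain ⟨n', h1, h2⟩ := ih
    exact ⟨n', h1, by simpa [sylVal, zpow_add, mul_assoc] using h2⟩
  | del P Q j a c n hc hr ih =>
    obtain ⟨n', h1, h2⟩ := ih
    refine ⟨c + n', by omega, ?_⟩
    have := pc_mul (pc_conj (sylVal P) hc) h2
    simpa [sylVal, mul_assoc] using this

/-- Sign exponent. -/
def sgn (b : Bool) : ℤ := cond b 1 (-1)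

/-- Letters as syllables. -/
def syl (U : Word m) : List (Fin m × ℤ) := U.map fun x => (x.1, sgn x.2)

theorem syl_append (U V : Word m) : syl (U ++ V) = syl U ++ syl V := by simp [syl]

theorem sylVal_syl (U : Word m) : sylVal (syl U) = evalW U := by
  induction U with
  | nil => rfl
  | cons x U ih =>
    have h1 : sylVal (syl (x :: U)) = FreeGroup.of x.1 ^ sgn x.2 * sylVal (syl U) := by
      simp [sylVal, syl]
    have h2 : evalW (x :: U) = evalW [x] * evalW U := by simp [evalW]
    rw [h1, h2, ih]
    congr 1
    obtain ⟨i, b⟩ := x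
    cases b <;> simp [sgn, evalW, FreeGroup.of, FreeGroup.invRev]

theorem red_step {U V : Word m} (h : FreeGroup.Red.Step U V) (n : ℕ) :
    Red E (syl U) n ↔ Red E (syl V) n := by
  obtain @⟨P, Q, i, b⟩ := h
  have hb : sgn b + sgn (!b) = 0 := by cases b <;> simp [sgn]
  have e1 : syl (P ++ (i, b) :: (i, !b) :: Q) =
    syl P ++ (i, sgn b) :: (i, sgn (!b)) :: syl Q := by simp [syl]
  rw [e1, syl_append]
  constructor
  · intro h
    have h2 := h.join _ _ _ _ _ rfl
    rw [hb] at h2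
    exact h2.zero _ _ _ rfl
  · intro h
    refine Red.merge _ _ _ _ _ _ ?_
    rw [hb]
    exact Red.del' _ _ i 0 (k := 0) (by simpa using pc_one) h rfl rfl (by simp)

/-- Reducibility as a predicate on the free group. -/
def RedG (E : Fin m → Set ℕ) (n : ℕ) (g : FreeGroup (Fin m)) : Prop :=
  Quot.lift (fun U : Word m => Red E (syl U) n) (fun _ _ h => propext (red_step h n)) g

theorem redG_mk (n : ℕ) (U : Word m) : RedG E n (FreeGroup.mk U) ↔ Red E (syl U) n := Iff.rfl

theorem redG_mul {a b : ℕ} {g h : FreeGroup (Fin m)} (hg : RedG E a g) (hh : RedG E b h) :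
    RedG E (a + b) (g * h) := by
  induction g using Quot.inductionOn with | _ U =>
  induction h using Quot.inductionOn with | _ V =>
  have := Red.insert hg [] (syl V) hh
  simp only [List.nil_append, ← syl_append] at this
  exact this

theorem redG_conj {a : ℕ} {g : FreeGroup (Fin m)} (t : FreeGroup (Fin m)) (hg : RedG E a g) :
    RedG E a (t * g * t⁻¹) := by
  induction g using Quot.inductionOn with | _ U =>
  induction t using Quot.inductionOn with | _ V =>
  have h1 : RedG E 0 (FreeGroup.mk V * (FreeGroup.mk V)⁻¹) := by
    rw [mul_inv_cancel]; exact Red.nil 0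
  rw [FreeGroup.inv_mk, FreeGroup.mul_mk, redG_mk, syl_append] at h1
  have := Red.insert hg _ _ h1
  simp only [← syl_append] at this
  exact this

theorem red_replicate (i : Fin m) (b : Bool) (k n : ℕ) : ∀ f : ℤ, Red E [(i, f + k * sgn b)] n →
    Red E ((i, f) :: syl (List.replicate k (i, b))) n := by
  induction k with
  | zero => intro f h; simpa [syl] using h
  | succ k ih =>
    intro f h
    refine Red.merge' [] (syl (List.replicate k (i, b))) i f (sgn b) (ih (f + sgn b) ?_) (by simp)
      (by simp [syl, List.replicate_succ])
    have e1 : f + sgn b + (k : ℤ) * sgn b = f + ((k + 1 : ℕ) : ℤ) * sgn b := by push_cast; ring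
    rwa [e1]

theorem of_pow (i : Fin m) (k : ℕ) :
    FreeGroup.of i ^ k = FreeGroup.mk (List.replicate k (i, true)) := by
  induction k with
  | zero => rfl
  | succ k ih => rw [pow_succ, ih, FreeGroup.of, FreeGroup.mul_mk, List.replicate_succ']

theorem redG_rel {r : FreeGroup (Fin m)} (h : r ∈ Rel2 m E ∨ r⁻¹ ∈ Rel2 m E) : RedG E 1 r := by
  have key : ∀ (i : Fin m) (k : ℕ) (b : Bool), k ∈ E i → k ≠ 0 →
      Red E (syl (List.replicate k (i, b))) 1 := by
    intro i k b hk hk0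
    refine (red_replicate i b k 1 0 ?_).zero [] _ i rfl
    refine Red.del' [] [] i _ (pc_single ?_) (Red.nil 0) rfl rfl rfl
    cases b
    · right; exact ⟨i, k, hk, hk0, by simp [sgn]⟩
    · left; exact ⟨i, k, hk, hk0, by simp [sgn]⟩
  rcases h with ⟨i, k, hk, hk0, rfl⟩ | ⟨i, k, hk, hk0, h⟩
  · rw [of_pow]; exact key i k true hk hk0
  · rw [inv_eq_iff_eq_inv, of_pow, FreeGroup.inv_mk] at h
    rw [h, redG_mk]
    have := key i k false hk hk0
    simpa [FreeGroup.invRev] using this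

theorem redG_of_pc {n : ℕ} {g : FreeGroup (Fin m)} (h : IsProdConj (Rel2 m E) n g) :
    RedG E n g := by
  rw [isProdConj_iff] at h
  obtain ⟨l, rfl, h, rfl⟩ := h
  induction l with
  | nil => exact Red.nil 0
  | cons x l ih =>
    obtain ⟨r, s, hr, rfl⟩ := h x (by simp)
    rw [List.prod_cons, List.length_cons, add_comm]
    exact redG_mul (redG_conj _ (redG_rel hr)) (ih fun y hy => h y (by simp [hy]))

theorem mu2_le {n : ℕ} {g : FreeGroup (Fin m)} (h : IsProdConj (Rel2 m E) n g) :
    mu2 m E g ≤ n := Nat.sInf_le h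

theorem mu2_spec {g : FreeGroup (Fin m)} (h : g ∈ Subgroup.normalClosure (Rel2 m E)) :
    IsProdConj (Rel2 m E) (mu2 m E g) g :=
  Nat.sInf_mem (s := {k | IsProdConj (Rel2 m E) k g}) (pc_exists h)

/-- Lemma 5.2: if `U = 1` in `G_2` and `U` has property (E) (i.e. `U` is nonempty and
its first letter `b_1` and last letter `b_2` satisfy `b_1 ≠ b_2⁻¹` and `b_1 ≠ b_2`),
then there is a factorization `U ≡ U_1 U_2` with `|U_1|, |U_2| > 0` such that
`U_1 = 1` and `U_2 = 1` in `G_2` and `μ_2(U) = μ_2(U_1) + μ_2(U_2)`. -/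
theorem statement16 (m : ℕ) (E : Fin m → Set ℕ)
    (hE : ∀ i, E i = {0} ∨ ∃ n : ℕ, 0 < n ∧
      (E i = {n} ∨ E i = {k | ∃ t : ℕ, 1 ≤ t ∧ k = t * n}))
    (U : Word m)
    (hU : evalW U ∈ Subgroup.normalClosure (Rel2 m E))
    (hne : U ≠ [])
    (hprop : ∀ x y : Fin m × Bool, U.head? = some x → U.getLast? = some y →
      x ≠ y ∧ x ≠ (y.1, !y.2)) :
    ∃ U1 U2 : Word m, U = U1 ++ U2 ∧ 0 < U1.length ∧ 0 < U2.length ∧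
      evalW U1 ∈ Subgroup.normalClosure (Rel2 m E) ∧
      evalW U2 ∈ Subgroup.normalClosure (Rel2 m E) ∧
      mu2 m E (evalW U) = mu2 m E (evalW U1) + mu2 m E (evalW U2) := by
  obtain ⟨x, hx⟩ : ∃ x, U.head? = some x := by
    cases U with
    | nil => exact absurd rfl hne
    | cons a t => exact ⟨a, rfl⟩
  obtain ⟨y, hy⟩ : ∃ y, U.getLast? = some y := ⟨_, List.getLast?_eq_getLast_of_ne_nil hne⟩
  have hxy : x.1 ≠ y.1 := by
    obtain ⟨h1, h2⟩ := hprop x y hx hy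
    obtain ⟨i, b⟩ := x
    obtain ⟨j, c⟩ := y
    rintro h
    simp only at h
    subst h
    cases b <;> cases c <;> simp at h1 h2
  have hred : Red E (syl U) (mu2 m E (evalW U)) := redG_of_pc (mu2_spec hU)
  obtain ⟨W1, W2, n1, n2, hW, h1, h2, hn, hr1, hr2⟩ := hred.split (x.1, sgn x.2) (y.1, sgn y.2)
    (by simp [syl, hx]) (by simp [syl, hy]) hxy
  obtain ⟨U1, U2, rfl, rfl, rfl⟩ := List.map_eq_append_iff.1 hW
  obtain ⟨k1, hk1, hp1⟩ := hr1.sound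
  obtain ⟨k2, hk2, hp2⟩ := hr2.sound
  change IsProdConj _ _ (sylVal (syl U1)) at hp1
  change IsProdConj _ _ (sylVal (syl U2)) at hp2
  rw [sylVal_syl] at hp1 hp2
  refine ⟨U1, U2, rfl, ?_, ?_, pc_mem hp1, pc_mem hp2, ?_⟩
  · exact List.length_pos_iff.2 (by rintro rfl; simp at h1)
  · exact List.length_pos_iff.2 (by rintro rfl; simp at h2)
  · have a1 := mu2_le hp1
    have a2 := mu2_le hp2
    have a3 := mu2_le (pc_mul (mu2_spec (pc_mem hp1)) (mu2_spec (pc_mem hp2)))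
    have a4 : evalW (U1 ++ U2) = evalW U1 * evalW U2 := by simp [evalW]
    rw [← a4] at a3
    omega

end Stmt16
end

section
/- Let c be a finite closed path in the tessellation 𝕋 of the plane into unit squares whose edges are edges of 𝕋. Then there exists a finite sequence of elementary homotopies of types 1–2 turning c into a single point, and the minimal number m_2(c) of type-2 elementary homotopies over all such sequences equals the minimal number n such that the word φ(c) is a product of n conjugates of the words (a_2a_1a_2^{-1}a_1^{-1})^{±1} in the free group F(a_1, a_2). [combination of Lemma 10.1 with the van Kampen Lemma 2.1, the core of Theorem 1.5] -/
namespace Stmt18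

/-- A directed edge (step) of the unit-square tessellation `𝕋` of the plane, recorded
by its label: `(0, true)` is a horizontal edge labeled `a_1` (moving right),
`(0, false)` its inverse, `(1, true)` a vertical edge labeled `a_2` (moving up),
`(1, false)` its inverse. -/
abbrev GStep := Fin 2 × Bool

/-- The displacement vector of a step. -/
def vec (e : GStep) : ℤ × ℤ :=
  if e.1 = 0 then (if e.2 then (1, 0) else (-1, 0)) else (if e.2 then (0, 1) else (0, -1))

/-- The total displacement of a path; a path is closed iff its displacement is `0`. -/
def disp (L : List GStep) : ℤ × ℤ := (L.map vec).sum

/-- The step moving right. -/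
def eR : GStep := ((0 : Fin 2), true)
/-- The step moving left. -/
def eL : GStep := ((0 : Fin 2), false)
/-- The step moving up. -/
def eU : GStep := ((1 : Fin 2), true)
/-- The step moving down. -/
def eD : GStep := ((1 : Fin 2), false)

/-- The boundary paths of a unit square of `𝕋` starting at a given vertex: the four
rotations of the counterclockwise traversal and the four rotations of the clockwise
traversal.  (By translation invariance of `𝕋`, a list of steps is a boundary path of
some unit square of `𝕋` beginning at a given vertex iff it is one of these eight.) -/
def IsSqBoundary (L : List GStep) : Prop :=
  L ∈ [[eR, eU, eL, eD], [eU, eL, eD, eR], [eL, eD, eR, eU], [eD, eR, eU, eL],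
       [eU, eR, eD, eL], [eR, eD, eL, eU], [eD, eL, eU, eR], [eL, eU, eR, eD]]

/-- Elementary homotopy of type 1: delete a subpath `e e⁻¹`. -/
inductive EH1 : List GStep → List GStep → Prop
  | mk (c1 c2 : List GStep) (e : GStep) :
      EH1 (c1 ++ [e, (e.1, !e.2)] ++ c2) (c1 ++ c2)

/-- Elementary homotopy of type 2: if `∂s = u v` is a boundary path of a unit square
`s` of `𝕋`, replace the subpath `u` by `v⁻¹`. -/
inductive EH2 : List GStep → List GStep → Prop
  | mk (c1 c2 u v : List GStep) (h : IsSqBoundary (u ++ v)) :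
      EH2 (c1 ++ u ++ c2) (c1 ++ FreeGroup.invRev v ++ c2)

/-- `TurnsTo c k`: there is a finite sequence of elementary homotopies of types 1–2
turning the closed path `c` into a single point (the empty path) which contains
exactly `k` elementary homotopies of type 2. -/
def TurnsTo (c : List GStep) (k : ℕ) : Prop :=
  ∃ (N : ℕ) (seq : ℕ → List GStep) (ty : ℕ → Bool),
    seq 0 = c ∧ seq N = [] ∧
    (∀ i < N, cond (ty i) (EH2 (seq i) (seq (i + 1))) (EH1 (seq i) (seq (i + 1)))) ∧
    k = (List.range N).countP ty

/-- `g` is a product of exactly `n` conjugates of elements of `R ∪ R⁻¹`. -/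
def IsProdConj {G : Type*} [Group G] (R : Set G) (n : ℕ) (g : G) : Prop :=
  ∃ r s : Fin n → G,
    (∀ i, r i ∈ R ∨ (r i)⁻¹ ∈ R) ∧
    g = (List.ofFn fun i => s i * r i * (s i)⁻¹).prod

/-- The relator `a_2 a_1 a_2⁻¹ a_1⁻¹` of the presentation (10.1). -/
def Rcomm : Set (FreeGroup (Fin 2)) :=
  {FreeGroup.of 1 * FreeGroup.of 0 * (FreeGroup.of 1)⁻¹ * (FreeGroup.of 0)⁻¹}

/-! ### Inserting square boundaries into words -/

/-- `Ins c k w`: `w` arises from `c` by `k` successive insertions of square boundaries. -/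
inductive Ins (c : List GStep) : ℕ → List GStep → Prop
  | refl : Ins c 0 c
  | ins (k : ℕ) (A B R : List GStep) (h : Ins c k (A ++ B)) (hR : IsSqBoundary R) :
      Ins c (k + 1) (A ++ R ++ B)

theorem sq_rot (n : ℕ) (L : List GStep) (h : IsSqBoundary L) : IsSqBoundary (L.rotate n) := by
  induction n with
  | zero => simpa using h
  | succ n ih =>
    rw [← List.rotate_rotate]
    generalize L.rotate n = M at ih
    simp only [IsSqBoundary, List.mem_cons, List.not_mem_nil, or_false] at ih
    rcases ih with rfl | rfl | rfl | rfl | rfl | rfl | rfl | rfl <;>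
      simp [IsSqBoundary]

theorem sq_swap {A B : List GStep} (h : IsSqBoundary (A ++ B)) : IsSqBoundary (B ++ A) := by
  have := sq_rot A.length _ h
  rwa [List.rotate_append_length_eq] at this

theorem sq_inv {L : List GStep} (h : IsSqBoundary L) : IsSqBoundary (FreeGroup.invRev L) := by
  simp only [IsSqBoundary, List.mem_cons, List.not_mem_nil, or_false] at h
  rcases h with rfl | rfl | rfl | rfl | rfl | rfl | rfl | rfl <;>
    simp [IsSqBoundary, FreeGroup.invRev, eR, eL, eU, eD]

theorem Ins.cast {c w w' : List GStep} {k k' : ℕ} (h : Ins c k w) (hk : k = k') (hw : w = w') :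
    Ins c k' w' := by subst hk hw; exact h

theorem Ins.trans {c d e : List GStep} {k l : ℕ} (h : Ins c k d) (h2 : Ins d l e) :
    Ins c (k + l) e := by
  induction h2 with
  | refl => exact h
  | ins l A B R _ hR ih => exact Ins.ins (k + l) A B R ih hR

theorem Ins.ctx {c w : List GStep} {k : ℕ} (P Q : List GStep) (h : Ins c k w) :
    Ins (P ++ c ++ Q) k (P ++ w ++ Q) := by
  induction h with
  | refl => exact Ins.refl
  | ins l A B R _ hR ih =>
    exact (Ins.ins (c := P ++ c ++ Q) l (P ++ A) (B ++ Q) R (by simpa using ih) hR).cast rfl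
      (by simp)

theorem Ins.append {c d v w : List GStep} {k l : ℕ} (h : Ins c k v) (h2 : Ins d l w) :
    Ins (c ++ d) (k + l) (v ++ w) := by
  have a := h.ctx [] d
  have b := h2.ctx v []
  simp only [List.nil_append, List.append_nil] at a b
  exact a.trans b

theorem Ins.mid {c A B I : List GStep} {k l : ℕ} (h : Ins c k (A ++ B)) (h2 : Ins [] l I) :
    Ins c (k + l) (A ++ I ++ B) := by
  have b := h2.ctx A B
  simp only [List.append_nil] at b
  exact h.trans b

theorem Ins.rot {k : ℕ} {w : List GStep} (h : Ins [] k w) :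
    ∀ X Y, w = X ++ Y → Ins [] k (Y ++ X) := by
  induction h with
  | refl =>
    intro X Y h
    obtain ⟨rfl, rfl⟩ := List.append_eq_nil_iff.1 h.symm
    exact Ins.refl
  | ins l A B R _ hR ih =>
    intro X Y h
    rw [List.append_assoc] at h
    rcases List.append_eq_append_iff.1 h with ⟨X', rfl, h'⟩ | ⟨A', rfl, rfl⟩
    · rcases List.append_eq_append_iff.1 h' with ⟨X'', rfl, rfl⟩ | ⟨R', rfl, rfl⟩
      · have := ih (A ++ X'') Y (by simp)
        rw [← List.append_assoc] at this
        exact (Ins.ins (c := []) l (Y ++ A) X'' R this hR).cast rfl (by simp)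
      · have h0 : Ins [] 1 (R' ++ X') :=
          (Ins.ins (c := []) 0 [] [] (R' ++ X') Ins.refl (sq_swap hR)).cast rfl (by simp)
        exact (h0.mid (ih A B rfl)).cast (by omega) (by simp)
    · have := ih X (A' ++ B) (by simp)
      rw [List.append_assoc] at this
      exact (Ins.ins (c := []) l A' (B ++ X) R this hR).cast rfl (by simp)

theorem Ins.split {c w : List GStep} {k : ℕ} (h : Ins c k w) :
    ∀ c1 c2, c = c1 ++ c2 → ∃ k1 k2 w1 w2, k = k1 + k2 ∧ w = w1 ++ w2 ∧
      Ins c1 k1 w1 ∧ Ins c2 k2 w2 := by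
  induction h with
  | refl => intro c1 c2 h; exact ⟨0, 0, c1, c2, rfl, h, Ins.refl, Ins.refl⟩
  | ins l A B R _ hR ih =>
    intro c1 c2 h
    obtain ⟨k1, k2, w1, w2, rfl, hw, h1, h2⟩ := ih c1 c2 h
    rcases List.append_eq_append_iff.1 hw with ⟨X, rfl, rfl⟩ | ⟨X, rfl, rfl⟩
    · exact ⟨k1 + 1, k2, A ++ R ++ X, w2, by omega, by simp, Ins.ins k1 A X R h1 hR, h2⟩
    · exact ⟨k1, k2 + 1, w1, X ++ R ++ B, by omega, by simp, h1, Ins.ins k2 X B R h2 hR⟩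

theorem Ins.single {x : GStep} {w : List GStep} {k : ℕ} (h : Ins [x] k w) :
    ∃ k1 k2 I J, k = k1 + k2 ∧ w = I ++ x :: J ∧ Ins [] k1 I ∧ Ins [] k2 J := by
  induction h with
  | refl => exact ⟨0, 0, [], [], rfl, rfl, Ins.refl, Ins.refl⟩
  | ins l A B R _ hR ih =>
    obtain ⟨k1, k2, I, J, rfl, hw, h1, h2⟩ := ih
    rcases List.append_eq_append_iff.1 hw with ⟨X, rfl, rfl⟩ | ⟨X, rfl, hX⟩
    · exact ⟨k1 + 1, k2, A ++ R ++ X, J, by omega, by simp, Ins.ins k1 A X R h1 hR, h2⟩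
    · rcases X with _ | ⟨y, X⟩
      · simp only [List.nil_append] at hX
        subst hX
        exact ⟨k1 + 1, k2, I ++ R, J, by omega, by simp,
          (Ins.ins k1 I [] R (by simpa using h1) hR).cast rfl (by simp), h2⟩
      · simp only [List.cons_append, List.cons.injEq] at hX
        obtain ⟨rfl, rfl⟩ := hX
        exact ⟨k1, k2 + 1, I, X ++ R ++ B, by omega, by simp, h1, Ins.ins k2 X B R h2 hR⟩

/-! ### Matching a letter in a freely trivial word -/

theorem mk_pair (x : GStep) : FreeGroup.mk [x, (x.1, !x.2)] = 1 := by
  have : FreeGroup.mk ([] ++ (x.1, x.2) :: (x.1, !x.2) :: []) = FreeGroup.mk ([] ++ []) :=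
    Quot.sound FreeGroup.Red.Step.not
  exact this

theorem red_single {y : GStep} {L : List GStep} (h : FreeGroup.Red L [y]) :
    ∃ L1 L2, L = L1 ++ y :: L2 ∧ FreeGroup.mk L1 = 1 ∧ FreeGroup.mk L2 = 1 := by
  induction h using Relation.ReflTransGen.head_induction_on with
  | refl => exact ⟨[], [], rfl, rfl, rfl⟩
  | head hs _ ih =>
    obtain ⟨L1, L2, hL, h1, h2⟩ := ih
    rcases hs with @⟨M1, M2, x, b⟩
    have hp : FreeGroup.mk [(x, b), (x, !b)] = 1 := mk_pair (x, b)
    rcases List.append_eq_append_iff.1 hL with ⟨X, rfl, rfl⟩ | ⟨X, rfl, hX⟩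
    · refine ⟨M1 ++ [(x, b), (x, !b)] ++ X, L2, by simp, ?_, h2⟩
      rw [← FreeGroup.mul_mk, ← FreeGroup.mul_mk, hp, mul_one, FreeGroup.mul_mk, h1]
    · rcases X with _ | ⟨z, X⟩
      · simp only [List.nil_append] at hX
        subst hX
        refine ⟨L1 ++ [(x, b), (x, !b)], L2, by simp, ?_, h2⟩
        rw [← FreeGroup.mul_mk, hp, mul_one, h1]
      · simp only [List.cons_append, List.cons.injEq] at hX
        obtain ⟨rfl, rfl⟩ := hX
        refine ⟨L1, X ++ [(x, b), (x, !b)] ++ M2, by simp, h1, ?_⟩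
        rw [← FreeGroup.mul_mk, ← FreeGroup.mul_mk, hp, mul_one, FreeGroup.mul_mk, h2]

theorem match_letter {x : GStep} {U V : List GStep} (h : FreeGroup.mk (U ++ x :: V) = 1) :
    (∃ V1 V2, V = V1 ++ (x.1, !x.2) :: V2 ∧ FreeGroup.mk V1 = 1) ∨
    (∃ U1 U2, U = U1 ++ (x.1, !x.2) :: U2 ∧ FreeGroup.mk U2 = 1) := by
  have h1 : FreeGroup.mk ((x.1, x.2) :: (V ++ U)) = 1 := by
    have e1 : FreeGroup.mk ((x.1, x.2) :: (V ++ U)) = FreeGroup.mk (x :: V) * FreeGroup.mk U := by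
      rw [FreeGroup.mul_mk]; rfl
    rw [← FreeGroup.mul_mk] at h
    rw [e1, eq_inv_of_mul_eq_one_left h, mul_inv_cancel]
  have h2 : FreeGroup.Red ((x.1, x.2) :: (V ++ U)) [] := by
    rw [FreeGroup.one_eq_mk, FreeGroup.Red.exact] at h1
    obtain ⟨d, ha, hb⟩ := h1
    rwa [FreeGroup.Red.nil_iff.1 hb] at ha
  obtain ⟨L1, L2, hL, ha, hb⟩ := red_single (FreeGroup.Red.cons_nil_iff_singleton.1 h2)
  rcases List.append_eq_append_iff.1 hL with ⟨X, rfl, rfl⟩ | ⟨X, rfl, hX⟩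
  · exact Or.inr ⟨X, L2, rfl, hb⟩
  · rcases X with _ | ⟨z, X⟩
    · simp only [List.nil_append] at hX
      exact Or.inr ⟨[], L2, by simpa using hX.symm, hb⟩
    · simp only [List.cons_append, List.cons.injEq] at hX
      obtain ⟨rfl, rfl⟩ := hX
      exact Or.inl ⟨L1, X, rfl, ha⟩

/-- `c` becomes freely trivial after inserting `n` square boundaries. -/
def TI (c : List GStep) (n : ℕ) : Prop := ∃ w, Ins c n w ∧ FreeGroup.mk w = 1

theorem mk_cons' (x : GStep) (L : List GStep) :
    FreeGroup.mk (x :: L) = FreeGroup.mk [x] * FreeGroup.mk L := by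
  rw [FreeGroup.mul_mk]; rfl

/-- The group element of a single letter. -/
def gl (x : GStep) : FreeGroup (Fin 2) := FreeGroup.mk [x]

theorem mk_cons_gl (x : GStep) (L : List GStep) :
    FreeGroup.mk (x :: L) = gl x * FreeGroup.mk L := mk_cons' x L

theorem gl_not (x : GStep) : gl (x.1, !x.2) = (gl x)⁻¹ := by
  rw [gl, gl, FreeGroup.inv_mk]; rfl

theorem TI.step {c d : List GStep} {n : ℕ} (h : TI c n) (hs : FreeGroup.Red.Step c d) :
    ∃ m ≤ n, TI d m := by
  obtain ⟨w, hI, hw⟩ := h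
  rcases hs with @⟨A, B, a, b⟩
  obtain ⟨x, hx⟩ : ∃ x : GStep, x = (a, b) := ⟨_, rfl⟩
  have hx' : (a, !b) = (x.1, !x.2) := by rw [hx]
  rw [← hx, hx'] at hI
  obtain ⟨k1, k2, A0, w2, rfl, rfl, hA, h2⟩ := hI.split A _ rfl
  obtain ⟨k3, k4, w3, w4, rfl, rfl, h3, h4⟩ := h2.split [x] _ rfl
  obtain ⟨k5, k6, w5, B0, rfl, rfl, h5, hB⟩ := h4.split [(x.1, !x.2)] B rfl
  obtain ⟨i1, i2, A1, I1, rfl, rfl, hA1, hI1⟩ := h3.single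
  obtain ⟨j1, j2, I2, B1, rfl, rfl, hI2, hB1⟩ := h5.single
  have hA' : Ins A (k1 + i1) (A0 ++ A1) := by simpa using hA.append hA1
  have hB' : Ins B (j2 + k6) (B1 ++ B0) := by simpa using hB1.append hB
  have hI' : Ins [] (i2 + j1) (I1 ++ I2) := by simpa using hI1.append hI2
  have hw' : FreeGroup.mk ((A0 ++ A1) ++ x :: ((I1 ++ I2) ++ (x.1, !x.2) :: (B1 ++ B0))) = 1 := by
    simpa using hw
  clear hw hI hA h2 h3 h4 h5 hB hA1 hI1 hI2 hB1
  generalize A0 ++ A1 = P at *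
  generalize B1 ++ B0 = Q at *
  generalize I1 ++ I2 = I at *
  have hPQ := hA'.append hB'
  rcases match_letter hw' with ⟨V1, V2, hV, h1⟩ | ⟨U1, U2, rfl, h1⟩
  · rcases List.append_eq_append_iff.1 hV with ⟨X, rfl, hX⟩ | ⟨X, rfl, hX⟩
    · rcases X with _ | ⟨z, X⟩
      · -- the pair matches itself
        simp only [List.append_nil] at h1
        refine ⟨_, ?_, P ++ Q, hPQ, ?_⟩
        · omega
        · simp only [← FreeGroup.mul_mk, mk_cons_gl, gl_not, h1] at hw' ⊢
          simpa using hw'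
      · -- the match lies to the right
        simp only [List.cons_append, List.cons.injEq] at hX
        obtain ⟨rfl, rfl⟩ := hX
        have := Ins.mid (A := P ++ X) (B := (x.1, !x.2) :: V2) (by simpa using hPQ) hI'
        refine ⟨_, ?_, _, this, ?_⟩
        · omega
        · simp only [← FreeGroup.mul_mk, mk_cons_gl, gl_not] at hw' h1 ⊢
          rw [← hw']
          have e : FreeGroup.mk I = (FreeGroup.mk X)⁻¹ * gl x := by
            rw [eq_inv_of_mul_eq_one_left h1]; group
          rw [e]; group
    · rcases X with _ | ⟨z, X⟩
      · simp only [List.append_nil] at hw' hI'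
        refine ⟨_, ?_, P ++ Q, hPQ, ?_⟩
        · omega
        · simp only [← FreeGroup.mul_mk, mk_cons_gl, gl_not, h1] at hw' ⊢
          simpa using hw'
      · -- the match lies inside the inserted part
        simp only [List.cons_append, List.cons.injEq] at hX
        obtain ⟨rfl, rfl⟩ := hX
        have hr := hI'.rot (V1 ++ [(x.1, !x.2)]) X (by simp)
        have := Ins.mid hPQ hr
        refine ⟨_, ?_, _, this, ?_⟩
        · omega
        · have e := hw'
          simp only [List.append_assoc, List.cons_append, ← FreeGroup.mul_mk, mk_cons_gl,
            gl_not, h1] at e ⊢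
          have e0 : FreeGroup.mk ([] : List GStep) = 1 := rfl
          simp only [e0]
          refine Eq.trans ?_ e
          group
  · -- the match lies to the left
    have := Ins.mid (A := U1) (B := (x.1, !x.2) :: U2 ++ Q) (by simpa using hPQ) hI'
    refine ⟨_, ?_, _, this, ?_⟩
    · omega
    · simp only [← FreeGroup.mul_mk, mk_cons_gl, gl_not, h1] at hw' ⊢
      refine Eq.trans ?_ hw'
      group

theorem TI.red {c d : List GStep} {n : ℕ} (h : TI c n) (hs : FreeGroup.Red c d) :
    ∃ m ≤ n, TI d m := by
  induction hs with
  | refl => exact ⟨n, le_rfl, h⟩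
  | tail _ hs ih =>
    obtain ⟨m, hm, h'⟩ := ih
    obtain ⟨l, hl, h''⟩ := h'.step hs
    exact ⟨l, hl.trans hm, h''⟩

/-! ### Sequences of homotopies, inductively -/

/-- Inductive form of `TurnsTo`. -/
inductive TT : List GStep → ℕ → Prop
  | nil : TT [] 0
  | one (c d : List GStep) (k : ℕ) : EH1 c d → TT d k → TT c k
  | two (c d : List GStep) (k : ℕ) : EH2 c d → TT d k → TT c (k + 1)

theorem TT_of {N : ℕ} : ∀ (seq : ℕ → List GStep) (ty : ℕ → Bool), seq N = [] →
    (∀ i < N, cond (ty i) (EH2 (seq i) (seq (i + 1))) (EH1 (seq i) (seq (i + 1)))) →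
    TT (seq 0) ((List.range N).countP ty) := by
  induction N with
  | zero => intro seq ty h _; rw [h]; exact TT.nil
  | succ N ih =>
    intro seq ty h hs
    have h1 := ih (fun i => seq (i + 1)) (fun i => ty (i + 1)) h
      (fun i hi => hs (i + 1) (by omega))
    have h0 := hs 0 (by omega)
    rw [List.range_succ_eq_map, List.countP_cons, List.countP_map]
    cases ht : ty 0 with
    | true => rw [ht] at h0; simpa [Function.comp_def] using TT.two _ _ _ h0 h1
    | false => rw [ht] at h0; simpa [Function.comp_def] using TT.one _ _ _ h0 h1

theorem turnsTo_iff {c : List GStep} {k : ℕ} : TurnsTo c k ↔ TT c k := by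
  constructor
  · rintro ⟨N, seq, ty, rfl, h1, h2, rfl⟩
    exact TT_of seq ty h1 h2
  · intro h
    have key : ∀ (b : Bool) (c d : List GStep) (k : ℕ), cond b (EH2 c d) (EH1 c d) →
        TurnsTo d k → TurnsTo c (k + if b then 1 else 0) := by
      rintro b c d k h0 ⟨N, seq, ty, rfl, h1, h2, rfl⟩
      refine ⟨N + 1, fun i => Nat.casesOn i c seq, fun i => Nat.casesOn i b ty, rfl, h1, ?_, ?_⟩
      · intro i hi
        cases i with
        | zero => exact h0
        | succ i => exact h2 i (by omega)
      · rw [List.range_succ_eq_map, List.countP_cons, List.countP_map]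
        rfl
    induction h with
    | nil => exact ⟨0, fun _ => [], fun _ => true, rfl, rfl, by simp, rfl⟩
    | one c d k h _ ih => exact key false c d k h ih
    | two c d k h _ ih => exact key true c d k h ih

theorem TT.of_step {c d : List GStep} {k : ℕ} (hs : FreeGroup.Red.Step c d) (h : TT d k) :
    TT c k := by
  rcases hs with @⟨A, B, a, b⟩
  refine TT.one _ _ _ ?_ h
  have := EH1.mk A B (a, b)
  simpa using this

theorem TT.of_red {c d : List GStep} {k : ℕ} (hs : FreeGroup.Red c d) (h : TT d k) :
    TT c k := by
  induction hs using Relation.ReflTransGen.head_induction_on with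
  | refl => exact h
  | head hs _ ih => exact TT.of_step hs ih

theorem TT.of_ins {c w : List GStep} {n k : ℕ} (hI : Ins c n w) (h : TT w k) :
    TT c (n + k) := by
  induction hI generalizing k with
  | refl => simpa using h
  | ins l A B R _ hR ih =>
    have : EH2 (A ++ B) (A ++ R ++ B) := by
      have := EH2.mk A B [] (FreeGroup.invRev R) (sq_inv hR)
      simpa [FreeGroup.invRev_invRev] using this
    have := ih (TT.two _ _ _ this h)
    rwa [show l + 1 + k = l + (k + 1) by omega]

theorem red_nil {w : List GStep} (h : FreeGroup.mk w = 1) : FreeGroup.Red w [] := by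
  rw [FreeGroup.one_eq_mk, FreeGroup.Red.exact] at h
  obtain ⟨d, ha, hb⟩ := h
  rwa [FreeGroup.Red.nil_iff.1 hb] at ha

theorem TI.tt {c : List GStep} {n : ℕ} (h : TI c n) : TT c n := by
  obtain ⟨w, hI, hw⟩ := h
  exact TT.of_ins hI (TT.of_red (red_nil hw) TT.nil)

/-! ### Products of conjugates -/

section PC
variable {G : Type*} [Group G] {R : Set G}

theorem pc_zero : IsProdConj R 0 1 := ⟨Fin.elim0, Fin.elim0, fun i => i.elim0, by simp⟩

theorem pc_cons {n : ℕ} {g r s : G} (hr : r ∈ R ∨ r⁻¹ ∈ R) (h : IsProdConj R n g) :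
    IsProdConj R (n + 1) (s * r * s⁻¹ * g) := by
  obtain ⟨r', s', h1, rfl⟩ := h
  refine ⟨Fin.cons r r', Fin.cons s s', ?_, ?_⟩
  · intro i
    refine Fin.cases ?_ (fun i => ?_) i
    · simpa using hr
    · simpa using h1 i
  · simp [List.ofFn_succ]

theorem pc_succ {n : ℕ} {g : G} (h : IsProdConj R (n + 1) g) :
    ∃ r s g', (r ∈ R ∨ r⁻¹ ∈ R) ∧ IsProdConj R n g' ∧ g = s * r * s⁻¹ * g' := by
  obtain ⟨r', s', h1, rfl⟩ := h
  exact ⟨r' 0, s' 0, _, h1 0, ⟨fun i => r' i.succ, fun i => s' i.succ, fun i => h1 _, rfl⟩,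
    by simp [List.ofFn_succ]⟩

theorem pc_zero_iff {g : G} (h : IsProdConj R 0 g) : g = 1 := by
  obtain ⟨r', s', h1, rfl⟩ := h
  simp

theorem pc_mul {n m : ℕ} {g h : G} (hg : IsProdConj R n g) (hh : IsProdConj R m h) :
    ∃ l, IsProdConj R l (g * h) := by
  induction n generalizing g with
  | zero => rw [pc_zero_iff hg]; exact ⟨m, by simpa using hh⟩
  | succ n ih =>
    obtain ⟨r, s, g', hr, hg', rfl⟩ := pc_succ hg
    obtain ⟨l, hl⟩ := ih hg'
    exact ⟨l + 1, by rw [mul_assoc]; exact pc_cons hr hl⟩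

theorem pc_inv {n : ℕ} {g : G} (hg : IsProdConj R n g) : ∃ l, IsProdConj R l g⁻¹ := by
  induction n generalizing g with
  | zero => rw [pc_zero_iff hg]; exact ⟨0, by simpa using pc_zero⟩
  | succ n ih =>
    obtain ⟨r, s, g', hr, hg', rfl⟩ := pc_succ hg
    obtain ⟨l, hl⟩ := ih hg'
    have h1 : IsProdConj R 1 (s * r⁻¹ * s⁻¹ * 1) :=
      pc_cons (by rw [inv_inv]; exact hr.symm) pc_zero
    obtain ⟨m, hm⟩ := pc_mul hl h1
    exact ⟨m, by convert hm using 1; group⟩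

theorem pc_of_normalClosure {g : G} (hg : g ∈ Subgroup.normalClosure R) :
    ∃ n, IsProdConj R n g := by
  unfold Subgroup.normalClosure at hg
  induction hg using Subgroup.closure_induction with
  | mem x hx =>
    rw [Group.mem_conjugatesOfSet_iff] at hx
    obtain ⟨a, ha, hx⟩ := hx
    obtain ⟨c, rfl⟩ := isConj_iff.1 hx
    exact ⟨1, by simpa using pc_cons (s := c) (Or.inl ha) pc_zero⟩
  | one => exact ⟨0, pc_zero⟩
  | mul x y _ _ hx hy =>
    obtain ⟨n, hn⟩ := hx
    obtain ⟨m, hm⟩ := hy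
    exact pc_mul hn hm
  | inv x _ hx =>
    obtain ⟨n, hn⟩ := hx
    exact pc_inv hn

end PC

theorem sq_conj {L : List GStep} (h : IsSqBoundary L) :
    ∃ r s : FreeGroup (Fin 2), (r ∈ Rcomm ∨ r⁻¹ ∈ Rcomm) ∧ FreeGroup.mk L = s * r * s⁻¹ := by
  have e1 : FreeGroup.mk [eR] = FreeGroup.of 0 := rfl
  have e2 : FreeGroup.mk [eL] = (FreeGroup.of 0)⁻¹ := rfl
  have e3 : FreeGroup.mk [eU] = FreeGroup.of 1 := rfl
  have e4 : FreeGroup.mk [eD] = (FreeGroup.of 1)⁻¹ := rfl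
  have e : ∀ w x y z : GStep, FreeGroup.mk [w, x, y, z] =
      FreeGroup.mk [w] * FreeGroup.mk [x] * FreeGroup.mk [y] * FreeGroup.mk [z] := by
    intros; simp [FreeGroup.mul_mk]
  simp only [IsSqBoundary, List.mem_cons, List.not_mem_nil, or_false] at h
  simp only [Rcomm, Set.mem_singleton_iff]
  generalize (FreeGroup.of 0 : FreeGroup (Fin 2)) = a at *
  generalize (FreeGroup.of 1 : FreeGroup (Fin 2)) = b at *
  rcases h with rfl | rfl | rfl | rfl | rfl | rfl | rfl | rfl <;> rw [e] <;>
    simp only [e1, e2, e3, e4]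
  · exact ⟨(b * a * b⁻¹ * a⁻¹)⁻¹, 1, Or.inr (by group), by group⟩
  · exact ⟨(b * a * b⁻¹ * a⁻¹)⁻¹, a⁻¹, Or.inr (by group), by group⟩
  · exact ⟨(b * a * b⁻¹ * a⁻¹)⁻¹, a⁻¹ * b⁻¹ * a * b * a⁻¹ * b⁻¹, Or.inr (by group), by group⟩
  · exact ⟨(b * a * b⁻¹ * a⁻¹)⁻¹, b⁻¹, Or.inr (by group), by group⟩
  · exact ⟨b * a * b⁻¹ * a⁻¹, 1, Or.inl rfl, by group⟩
  · exact ⟨b * a * b⁻¹ * a⁻¹, b⁻¹, Or.inl rfl, by group⟩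
  · exact ⟨b * a * b⁻¹ * a⁻¹, b⁻¹ * a⁻¹ * b * a * b⁻¹ * a⁻¹, Or.inl rfl, by group⟩
  · exact ⟨b * a * b⁻¹ * a⁻¹, a⁻¹, Or.inl rfl, by group⟩

theorem TT.pc {c : List GStep} {k : ℕ} (h : TT c k) : IsProdConj Rcomm k (FreeGroup.mk c) := by
  induction h with
  | nil => exact pc_zero
  | one c d k h _ ih =>
    rcases h with ⟨c1, c2, e⟩
    rwa [← FreeGroup.mul_mk, ← FreeGroup.mul_mk, mk_pair, mul_one, FreeGroup.mul_mk]
  | two c d k h _ ih =>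
    rcases h with ⟨c1, c2, u, v, h⟩
    obtain ⟨r, s, hr, hs⟩ := sq_conj h
    have := pc_cons (s := FreeGroup.mk c1 * s) hr ih
    convert this using 1
    simp only [← FreeGroup.mul_mk, ← FreeGroup.inv_mk] at hs ⊢
    have e : FreeGroup.mk u = s * r * s⁻¹ * (FreeGroup.mk v)⁻¹ := by rw [← hs]; group
    rw [e]; group

theorem rel_word {r : FreeGroup (Fin 2)} (h : r ∈ Rcomm ∨ r⁻¹ ∈ Rcomm) :
    ∃ L, IsSqBoundary L ∧ FreeGroup.mk L = r := by
  rcases h with h | h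
  · exact ⟨[eU, eR, eD, eL], by simp [IsSqBoundary], by rw [Set.mem_singleton_iff.1 h]; rfl⟩
  · refine ⟨[eR, eU, eL, eD], by simp [IsSqBoundary], ?_⟩
    rw [← inv_inv r, Set.mem_singleton_iff.1 h]; rfl

theorem exists_TI {n : ℕ} {g : FreeGroup (Fin 2)} (h : IsProdConj Rcomm n g) :
    ∃ W, FreeGroup.mk W = g ∧ TI W n := by
  induction n generalizing g with
  | zero => exact ⟨[], by rw [pc_zero_iff h]; rfl, [], Ins.refl, rfl⟩
  | succ n ih =>
    obtain ⟨r, s, g', hr, hg', rfl⟩ := pc_succ h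
    obtain ⟨W, rfl, w, hI, hw⟩ := ih hg'
    obtain ⟨L, hL, rfl⟩ := rel_word hr
    obtain ⟨S, rfl⟩ : ∃ S, FreeGroup.mk S = s := ⟨s.toWord, FreeGroup.mk_toWord⟩
    refine ⟨S ++ L ++ FreeGroup.invRev S ++ W, ?_,
      S ++ L ++ FreeGroup.invRev L ++ (FreeGroup.invRev S ++ w), ?_, ?_⟩
    · simp only [← FreeGroup.mul_mk, ← FreeGroup.inv_mk]
    · refine Ins.ins n _ _ _ ?_ (sq_inv hL)
      simpa using hI.ctx (S ++ L ++ FreeGroup.invRev S) []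
    · simp only [← FreeGroup.mul_mk, ← FreeGroup.inv_mk, hw]; group

theorem TT_of_pc {n : ℕ} {c : List GStep} (h : IsProdConj Rcomm n (FreeGroup.mk c)) :
    ∃ k ≤ n, TT c k := by
  obtain ⟨W, hW, hT⟩ := exists_TI h
  obtain ⟨d, h1, h2⟩ := FreeGroup.Red.exact.1 hW
  obtain ⟨m, hm, hd⟩ := hT.red h1
  exact ⟨m, hm, TT.of_red h2 hd.tt⟩

theorem pc_of_closed {c : List GStep} (hc : disp c = 0) :
    ∃ n, IsProdConj Rcomm n (FreeGroup.mk c) := by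
  apply pc_of_normalClosure
  let q := QuotientGroup.mk' (Subgroup.normalClosure Rcomm)
  have hab : Commute (q (FreeGroup.of 1)) (q (FreeGroup.of 0)) := by
    have : q (FreeGroup.of 1 * FreeGroup.of 0 * (FreeGroup.of 1)⁻¹ * (FreeGroup.of 0)⁻¹) = 1 :=
      (QuotientGroup.eq_one_iff _).2 (Subgroup.subset_normalClosure rfl)
    simp only [map_mul, map_inv] at this
    rw [mul_inv_eq_one, mul_inv_eq_iff_eq_mul] at this
    exact this
  have key : ∀ L : List GStep, q (FreeGroup.mk L) =
      q (FreeGroup.of 0) ^ (disp L).1 * q (FreeGroup.of 1) ^ (disp L).2 := by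
    intro L
    induction L with
    | nil => simp [disp, ← FreeGroup.one_eq_mk]
    | cons x L ih =>
      have hd : disp (x :: L) = vec x + disp L := by simp [disp]
      rw [mk_cons', map_mul, ih, hd]
      generalize disp L = p
      have e1 : FreeGroup.mk [((0 : Fin 2), true)] = FreeGroup.of 0 := rfl
      have e2 : FreeGroup.mk [((0 : Fin 2), false)] = (FreeGroup.of 0)⁻¹ := rfl
      have e3 : FreeGroup.mk [((1 : Fin 2), true)] = FreeGroup.of 1 := rfl
      have e4 : FreeGroup.mk [((1 : Fin 2), false)] = (FreeGroup.of 1)⁻¹ := rfl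
      obtain ⟨i, b⟩ := x
      fin_cases i <;> cases b
      · simp [vec, e2, zpow_add, mul_assoc]
      · simp [vec, e1, zpow_add, mul_assoc]
      · have := (hab.inv_left.zpow_right p.1).eq
        simp only [vec, Fin.mk_one, e4, map_inv]
        simp [zpow_add, ← mul_assoc, this]
      · have := (hab.zpow_right p.1).eq
        simp only [vec, Fin.mk_one, e3]
        simp [zpow_add, ← mul_assoc, this]
  have := key c
  rw [hc] at this
  simp only [Prod.fst_zero, Prod.snd_zero, zpow_zero, mul_one] at this
  exact (QuotientGroup.eq_one_iff _).1 this

/-- Combination of Lemma 10.1 with the van Kampen Lemma 2.1 (the core of Theorem 1.5):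
every finite closed path `c` in `𝕋` can be turned into a single point by a finite
sequence of elementary homotopies of types 1–2, and the minimal number `m_2(c)` of
type-2 elementary homotopies in such a sequence equals the minimal number `n` such
that `φ(c)` is a product of `n` conjugates of `(a_2 a_1 a_2⁻¹ a_1⁻¹)^{±1}` in the free
group `F(a_1, a_2)`. -/
theorem statement18 (c : List GStep) (hc : disp c = 0) :
    (∃ k : ℕ, TurnsTo c k) ∧
    IsLeast {n : ℕ | IsProdConj Rcomm n (FreeGroup.mk c)} (sInf {k : ℕ | TurnsTo c k}) := by
  have hS : ∃ k : ℕ, TurnsTo c k := by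
    obtain ⟨n, hn⟩ := pc_of_closed hc
    obtain ⟨k, _, hk⟩ := TT_of_pc hn
    exact ⟨k, turnsTo_iff.2 hk⟩
  refine ⟨hS, ?_, ?_⟩
  · have : sInf {k : ℕ | TurnsTo c k} ∈ {k : ℕ | TurnsTo c k} := Nat.sInf_mem hS
    exact (turnsTo_iff.1 this).pc
  · intro n hn
    obtain ⟨k, hk, h⟩ := TT_of_pc hn
    exact (Nat.sInf_le (turnsTo_iff.2 h)).trans hk

end Stmt18
end

section
/- Let c be a finite closed path in the tessellation 𝕋 of the plane into unit squares whose edges are edges of 𝕋. Then there exists a finite sequence of elementary homotopies of types 1–2 turning c into a single point that contains at most |c|²/4 elementary homotopies of type 2; i.e., m_2(c) ≤ |c|²/4. [quantitative bound from the proofs of Theorem 1.5 via Lemmas 9.1 and 10.1] -/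
namespace Stmt19

/-- A directed edge (step) of the unit-square tessellation `𝕋` of the plane, recorded
by its label: `(0, true)` is a horizontal edge labeled `a_1` (moving right),
`(0, false)` its inverse, `(1, true)` a vertical edge labeled `a_2` (moving up),
`(1, false)` its inverse. -/
abbrev GStep := Fin 2 × Bool

/-- The displacement vector of a step. -/
def vec (e : GStep) : ℤ × ℤ :=
  if e.1 = 0 then (if e.2 then (1, 0) else (-1, 0)) else (if e.2 then (0, 1) else (0, -1))

/-- The total displacement of a path; a path is closed iff its displacement is `0`. -/
def disp (L : List GStep) : ℤ × ℤ := (L.map vec).sum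

/-- The step moving right. -/
def eR : GStep := ((0 : Fin 2), true)
/-- The step moving left. -/
def eL : GStep := ((0 : Fin 2), false)
/-- The step moving up. -/
def eU : GStep := ((1 : Fin 2), true)
/-- The step moving down. -/
def eD : GStep := ((1 : Fin 2), false)

/-- The boundary paths of a unit square of `𝕋` starting at a given vertex: the four
rotations of the counterclockwise traversal and the four rotations of the clockwise
traversal.  (By translation invariance of `𝕋`, a list of steps is a boundary path of
some unit square of `𝕋` beginning at a given vertex iff it is one of these eight.) -/
def IsSqBoundary (L : List GStep) : Prop :=
  L ∈ [[eR, eU, eL, eD], [eU, eL, eD, eR], [eL, eD, eR, eU], [eD, eR, eU, eL],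
       [eU, eR, eD, eL], [eR, eD, eL, eU], [eD, eL, eU, eR], [eL, eU, eR, eD]]

/-- Elementary homotopy of type 1: delete a subpath `e e⁻¹`. -/
inductive EH1 : List GStep → List GStep → Prop
  | mk (c1 c2 : List GStep) (e : GStep) :
      EH1 (c1 ++ [e, (e.1, !e.2)] ++ c2) (c1 ++ c2)

/-- Elementary homotopy of type 2: if `∂s = u v` is a boundary path of a unit square
`s` of `𝕋`, replace the subpath `u` by `v⁻¹`. -/
inductive EH2 : List GStep → List GStep → Prop
  | mk (c1 c2 u v : List GStep) (h : IsSqBoundary (u ++ v)) :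
      EH2 (c1 ++ u ++ c2) (c1 ++ FreeGroup.invRev v ++ c2)

/-- `TurnsTo c k`: there is a finite sequence of elementary homotopies of types 1–2
turning the closed path `c` into a single point (the empty path) which contains
exactly `k` elementary homotopies of type 2. -/
def TurnsTo (c : List GStep) (k : ℕ) : Prop :=
  ∃ (N : ℕ) (seq : ℕ → List GStep) (ty : ℕ → Bool),
    seq 0 = c ∧ seq N = [] ∧
    (∀ i < N, cond (ty i) (EH2 (seq i) (seq (i + 1))) (EH1 (seq i) (seq (i + 1)))) ∧
    k = (List.range N).countP ty

/-- `g` is a product of exactly `n` conjugates of elements of `R ∪ R⁻¹`. -/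
def IsProdConj {G : Type*} [Group G] (R : Set G) (n : ℕ) (g : G) : Prop :=
  ∃ r s : Fin n → G,
    (∀ i, r i ∈ R ∨ (r i)⁻¹ ∈ R) ∧
    g = (List.ofFn fun i => s i * r i * (s i)⁻¹).prod

/-- The relator `a_2 a_1 a_2⁻¹ a_1⁻¹` of the presentation (10.1). -/
def Rcomm : Set (FreeGroup (Fin 2)) :=
  {FreeGroup.of 1 * FreeGroup.of 0 * (FreeGroup.of 1)⁻¹ * (FreeGroup.of 0)⁻¹}

theorem TurnsTo.nil : TurnsTo [] 0 :=
  ⟨0, fun _ => [], fun _ => false, rfl, rfl, by simp, by simp⟩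

theorem TurnsTo.step {c d : List GStep} {k : ℕ} (b : Bool)
    (h : cond b (EH2 c d) (EH1 c d)) (ht : TurnsTo d k) :
    TurnsTo c (k + b.toNat) := by
  obtain ⟨N, seq, ty, h0, hN, hs, hk⟩ := ht
  refine ⟨N + 1, fun i => Nat.casesOn i c seq, fun i => Nat.casesOn i b ty, rfl, hN, ?_, ?_⟩
  · intro i hi
    cases i with
    | zero => simpa [h0] using h
    | succ i => exact hs i (by omega)
  · rw [List.range_succ_eq_map, List.countP_cons, List.countP_map, hk]
    cases b <;> rfl

theorem EH2.swap (c1 c2 : List GStep) (e f : GStep) (h : e.1 ≠ f.1) :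
    EH2 (c1 ++ e :: f :: c2) (c1 ++ f :: e :: c2) := by
  have := EH2.mk c1 c2 [e, f] [(e.1, !e.2), (f.1, !f.2)] (by
    revert e f; unfold IsSqBoundary; decide)
  simpa [FreeGroup.invRev] using this

theorem cancel_pair (e : GStep) (w : List GStep) : ∀ (c1 r : List GStep) (k : ℕ),
    (e.1, !e.2) ∉ w → TurnsTo (c1 ++ w ++ r) k →
    ∃ j ≤ k + w.length, TurnsTo (c1 ++ e :: (w ++ (e.1, !e.2) :: r)) j := by
  induction w with
  | nil =>
    intro c1 r k _ ht
    refine ⟨k, by simp, ?_⟩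
    have := EH1.mk c1 r e
    exact TurnsTo.step false (d := c1 ++ r) (by simpa using this) (by simpa using ht)
  | cons f w ih =>
    intro c1 r k hw ht
    simp only [List.mem_cons, not_or] at hw
    by_cases hf : e.1 = f.1
    · have hfe : f = e := by
        obtain ⟨e1, e2⟩ := e
        obtain ⟨f1, f2⟩ := f
        cases e2 <;> cases f2 <;> simp_all
      subst hfe
      obtain ⟨j, hj, hjt⟩ := ih (c1 ++ [f]) r k hw.2 (by simpa using ht)
      exact ⟨j, by simp; omega, by simpa using hjt⟩
    · obtain ⟨j, hj, hjt⟩ := ih (c1 ++ [f]) r k hw.2 (by simpa using ht)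
      refine ⟨j + 1, by simp; omega, ?_⟩
      exact TurnsTo.step true (EH2.swap c1 _ e f hf) (by simpa using hjt)

/-- The inner product of a vector with the direction of `e`. -/
def dotv (e : GStep) (p : ℤ × ℤ) : ℤ := (vec e).1 * p.1 + (vec e).2 * p.2

theorem dot_nonneg (e f : GStep) (h : f ≠ (e.1, !e.2)) : 0 ≤ dotv e (vec f) := by
  revert e f; decide

theorem dot_self (e : GStep) : dotv e (vec e) = 1 := by
  revert e; decide

theorem dot_disp_nonneg (e : GStep) (w : List GStep) (h : (e.1, !e.2) ∉ w) :
    0 ≤ dotv e (disp w) := by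
  induction w with
  | nil => simp [disp, dotv]
  | cons f w ih =>
    simp only [List.mem_cons, not_or] at h
    have h1 := ih h.2
    have h2 := dot_nonneg e f (fun hh => h.1 hh.symm)
    simp only [disp, dotv, List.map_cons, List.sum_cons, Prod.fst_add, Prod.snd_add] at *
    linarith

theorem vec_inv (e : GStep) : vec e + vec (e.1, !e.2) = 0 := by
  revert e; decide

theorem main_aux (n : ℕ) : ∀ c : List GStep, c.length = n → disp c = 0 →
    ∃ k : ℕ, TurnsTo c k ∧ 4 * k ≤ c.length ^ 2 := by
  induction n using Nat.strong_induction_on with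
  | _ n ih =>
    intro c hn hc
    cases c with
    | nil => exact ⟨0, TurnsTo.nil, by simp⟩
    | cons e t =>
      have hmem : (e.1, !e.2) ∈ t := by
        by_contra hne
        have h1 := dot_disp_nonneg e t hne
        have h2 := dot_self e
        have h3 : dotv e (disp (e :: t)) = 0 := by rw [hc]; simp [dotv]
        simp only [disp, dotv, List.map_cons, List.sum_cons, Prod.fst_add, Prod.snd_add] at *
        linarith
      obtain ⟨w, r, rfl, hw⟩ := List.eq_append_cons_of_mem hmem
      have hd : disp (w ++ r) = 0 := by
        rw [← hc]
        have := vec_inv e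
        simp only [disp, List.map_cons, List.sum_cons, List.map_append, List.sum_append]
        linear_combination -this
      obtain ⟨k, hk, hk4⟩ := ih (w ++ r).length (by simp at hn ⊢; omega) (w ++ r) rfl hd
      obtain ⟨j, hj, hjt⟩ := cancel_pair e w [] r k hw (by simpa using hk)
      refine ⟨j, by simpa using hjt, ?_⟩
      simp only [List.length_append, List.length_cons] at *
      nlinarith

/-- Quantitative bound from the proofs of Theorem 1.5 via Lemmas 9.1 and 10.1: every
finite closed path `c` in `𝕋` can be turned into a single point by a finite sequence
of elementary homotopies of types 1–2 containing at most `|c|²/4` elementary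
homotopies of type 2; i.e. `m_2(c) ≤ |c|²/4`. -/
theorem statement19 (c : List GStep) (hc : disp c = 0) :
    ∃ k : ℕ, TurnsTo c k ∧ 4 * k ≤ c.length ^ 2 := by
  exact main_aux _ c rfl hc

end Stmt19
end
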